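/- For every x ∈ [0,1], 𝓑(x) = 1 − A⁻¹(x), where A⁻¹ : [0,1] → [0,1/2] is the inverse of the dyadic suspension bridge function A. -/

import Mathlib

open MeasureTheory

noncomputable section

/-- The dyadic subinterval `[k/2^n, (k+1)/2^n]` of `[0,1]`. -/
def dyadicI (n k : ℕ) : Set ℝ := Set.Icc ((k : ℝ) / 2 ^ n) (((k : ℝ) + 1) / 2 ^ n)

/-- The Haar function of the dyadic interval `[k/2^n, (k+1)/2^n]`: it equals `-1` on the
left half of the interval, `+1` on its right half and `0` elsewhere. -/
def haar (n k : ℕ) (x : ℝ) : ℝ :=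
  if x ∈ Set.Ico ((k : ℝ) / 2 ^ n) ((2 * (k : ℝ) + 1) / 2 ^ (n + 1)) then -1
  else if x ∈ Set.Ico ((2 * (k : ℝ) + 1) / 2 ^ (n + 1)) (((k : ℝ) + 1) / 2 ^ n) then 1
  else 0

/-- The Haar coefficient `a_J = μ(J)⁻¹ ∫_I f h_J` of `f` at `J = [k/2^n, (k+1)/2^n]`. -/
def haarCoeff (f : ℝ → ℝ) (n k : ℕ) : ℝ :=
  2 ^ n * ∫ x in Set.Icc (0 : ℝ) 1, f x * haar n k x

/-- The dyadic square function `Sf = √(Σ_J a_J² χ_J)`. -/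
def sqFn (f : ℝ → ℝ) (x : ℝ) : ℝ :=
  Real.sqrt (∑' p : ℕ × ℕ, (haarCoeff f p.1 p.2) ^ 2 * (dyadicI p.1 p.2).indicator 1 x)

/-- A test function for the Bellman function: integrable on `I = [0,1]`, with zero mean
and with dyadic square function essentially bounded by `1` on `I`. -/
def Admissible (f : ℝ → ℝ) : Prop :=
  IntegrableOn f (Set.Icc 0 1) ∧ (∫ x in Set.Icc (0 : ℝ) 1, f x) = 0 ∧
    ∀ᵐ x ∂(volume.restrict (Set.Icc (0 : ℝ) 1)), sqFn f x ≤ 1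

/-- The Bellman function `𝓑(x) = sup{ μ{f ≥ x} : ∫_I f = 0, ‖Sf‖_∞ ≤ 1 }`. -/
def bellman (x : ℝ) : ℝ :=
  sSup { m : ℝ | ∃ f : ℝ → ℝ, Admissible f ∧
    m = (volume { y ∈ Set.Icc (0 : ℝ) 1 | x ≤ f y }).toReal }

/-- The nonlinear mean `M[a,b] = (a+b)/√(4+(a-b)²)`. -/
def nlMean (a b : ℝ) : ℝ := (a + b) / Real.sqrt (4 + (a - b) ^ 2)

section Algebra

lemma bridge_poly_nonneg {a b c : ℝ} (ha : 0 ≤ a) (hb : 0 ≤ b) (hc : 0 ≤ c) (hb1 : b ≤ 1)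
    (hc1 : c ≤ 1) {S P α D : ℝ} (hS : S = a * (b + c)) (hP : P = b * c) (hα : α = a ^ 2)
    (hD : D = (b - c) ^ 2) :
    0 ≤ 12 * S + 20 * P + 4 * α - 8 * S * P + 4 * S * α + 4 * P ^ 2 + 4 * α * P - S * P ^ 2
      + S * α ^ 2 - 4 * S ^ 2 - S ^ 2 * α + S ^ 2 * P + D * (3 + α) * (9 / 7 - S) := by
  have hS0 : 0 ≤ S := by rw [hS]; positivity
  have hP0 : 0 ≤ P := by rw [hP]; positivity
  have hP1 : P ≤ 1 := by rw [hP]; nlinarith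
  have hα0 : 0 ≤ α := by rw [hα]; positivity
  have hD0 : 0 ≤ D := by rw [hD]; positivity
  have hDP : D + P ≤ 1 := by rw [hD, hP]; nlinarith [mul_nonneg hb hc, mul_nonneg (sub_nonneg.2 hb1) (sub_nonneg.2 hc1), mul_nonneg hb (sub_nonneg.2 hb1), mul_nonneg hc (sub_nonneg.2 hc1), mul_nonneg (mul_nonneg hb hc) (sub_nonneg.2 hb1)]
  have hSS : S ^ 2 = α * (D + 4 * P) := by rw [hS, hα, hD, hP]; ring
  have hD1 : D ≤ 1 := by linarith
  have h1 : 0 ≤ S * (12 - 8 * P - P ^ 2 - 3 * D) := by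
    apply mul_nonneg hS0; nlinarith
  have h2 : 0 ≤ S ^ 2 * P := by positivity
  have h3 : 0 ≤ D * (3 + α) * (9 / 7) := by positivity
  have h4 : 3 * (S * α) ≤ S * α * (4 - D) := by nlinarith [mul_nonneg hS0 hα0]
  suffices h : 0 ≤ 20 * P + 4 * α + 4 * P ^ 2 + 4 * α * P + S * α ^ 2 - 4 * S ^ 2 - S ^ 2 * α
      + 3 * (S * α) by linarith
  have hSα : S * α ^ 2 - S ^ 2 * α + 3 * (S * α) = S * α * (α - S + 3) := by ring
  have hS2 : S ≤ 2 * a := by rw [hS]; nlinarith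
  rcases le_total a 1 with h | h
  · have : 0 ≤ S * α * (α - S + 3) := by
      apply mul_nonneg (by positivity); nlinarith
    have hα1 : α ≤ 1 := by rw [hα]; nlinarith
    nlinarith [mul_nonneg hα0 (sub_nonneg.2 hDP), mul_nonneg hα0 hP0, mul_nonneg hP0 (sub_nonneg.2 hα1)]
  · have ht : ∃ t, t = b + c := ⟨_, rfl⟩
    obtain ⟨t, ht⟩ := ht
    have ht0 : 0 ≤ t := by rw [ht]; positivity
    have ht2 : t ≤ 2 := by linarith
    have hP2 : t - 1 ≤ P := by rw [ht, hP]; nlinarith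
    have hSt : S = a * t := by rw [hS, ht]
    have hcube : 0 ≤ a ^ 3 := by positivity
    have e : 20 * P + 4 * α + 4 * P ^ 2 + 4 * α * P + S * α ^ 2 - 4 * S ^ 2 - S ^ 2 * α
      + 3 * (S * α) = 4 * P ^ 2 + 20 * P + a ^ 2 * (4 + 4 * P - 4 * t ^ 2)
        + a ^ 3 * t * (a ^ 2 - a * t + 3) := by rw [hSt, hα]; ring
    have hP2' : 0 ≤ P ^ 2 := sq_nonneg P
    rw [e]
    rcases le_total t 1 with h' | h'
    · have k1 : a ^ 2 * (t * (4 - t)) ≤ a ^ 3 * t * (a ^ 2 - a * t + 3) := by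
        have : 4 - t ≤ a * (a ^ 2 - a * t + 3) := by nlinarith [mul_nonneg (sub_nonneg.2 h) (sub_nonneg.2 h), mul_nonneg (mul_nonneg (sub_nonneg.2 h) (sub_nonneg.2 h)) (sub_nonneg.2 h), mul_nonneg (sub_nonneg.2 h) ht0, mul_nonneg (sub_nonneg.2 h) (sub_nonneg.2 h')]
        have := mul_le_mul_of_nonneg_left this (by positivity : 0 ≤ a ^ 2 * t)
        linarith
      have k2 : 0 ≤ a ^ 2 * (4 + 4 * P - 4 * t ^ 2 + t * (4 - t)) := by
        apply mul_nonneg (by positivity); nlinarith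
      linarith
    · have k2 : 0 ≤ 10 - 4 * a ^ 2 + a ^ 5 - 2 * a ^ 4 + 3 * a ^ 3 := by
        have hx : 0 ≤ a - 1 := sub_nonneg.2 h
        have : 10 - 4 * a ^ 2 + a ^ 5 - 2 * a ^ 4 + 3 * a ^ 3 = 7 + (a - 2) ^ 2 +
          2 * (a - 1) ^ 2 + 5 * (a - 1) ^ 3 + 3 * (a - 1) ^ 4 + (a - 1) ^ 5 := by ring
        rw [this]; positivity
      have k3 : 0 ≤ a ^ 3 * (a ^ 2 - a + 3) := by
        apply mul_nonneg hcube; linarith [sq_nonneg (a - 1)]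
      have k4 : 0 ≤ t * ((2 - t) * (a ^ 3 * (a ^ 2 - a + 3)) +
          (t - 1) * (10 - 4 * a ^ 2 + a ^ 5 - 2 * a ^ 4 + 3 * a ^ 3)) := by
        have : 0 ≤ 2 - t := by linarith
        have : 0 ≤ t - 1 := by linarith
        positivity
      have k5 : 10 * (t * (t - 1)) ≤ 20 * P := by
        linarith [mul_nonneg (sub_nonneg.2 h') (sub_nonneg.2 ht2)]
      have k6 : a ^ 2 * (4 * t - 4 * t ^ 2) ≤ a ^ 2 * (4 + 4 * P - 4 * t ^ 2) := by
        apply mul_le_mul_of_nonneg_left _ (by positivity); linarith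
      linarith

set_option maxHeartbeats 2000000 in

lemma distrib_defect_nonneg {a b c : ℝ} (ha : 0 ≤ a) (hb : 0 ≤ b) (hc : 0 ≤ c) (hb1 : b ≤ 1)
    (hc1 : c ≤ 1) {r w n D S P α L G : ℝ} (hr : 0 ≤ r) (hw : 0 ≤ w)
    (hD : D = (b - c) ^ 2) (hn : n = 4 + (b - a) * (c - a)) (hS : S = a * (b + c))
    (hP : P = b * c) (hα : α = a ^ 2)
    (hr2 : r ^ 2 = 4 + D) (hw2 : w ^ 2 = n ^ 2 + 4 * D)
    (hL : L = 4 * S + 4 * n - 16 + D * (1 + α)) (hG : G = 2 * (4 + D) + L) :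
    0 ≤ (w + 2 * r) * (2 * (4 + D) * (2 * S + n - 8) - (4 + n) * L + w * G
      - 2 * S * r * (2 * S + 2 * n - 4)) + 2 * S * G * (4 + n) := by
  have hS0 : 0 ≤ S := by rw [hS]; positivity
  have hP0 : 0 ≤ P := by rw [hP]; positivity
  have hα0 : 0 ≤ α := by rw [hα]; positivity
  have hD0 : 0 ≤ D := by rw [hD]; positivity
  have hD1 : D ≤ 1 := by rw [hD]; nlinarith
  have hPD : P + D ≤ 1 := by rw [hD, hP]; nlinarith [mul_nonneg hb hc, mul_nonneg (sub_nonneg.2 hb1) (sub_nonneg.2 hc1), mul_nonneg hb (sub_nonneg.2 hb1), mul_nonneg hc (sub_nonneg.2 hc1), mul_nonneg (mul_nonneg hb hc) (sub_nonneg.2 hb1)]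
  have hnS : n = 4 + P - S + α := by rw [hn, hP, hS, hα]; ring
  have hn1 : 15 / 4 ≤ n := by
    have : 4 * (n - 4) = (2 * a - b - c) ^ 2 - D := by rw [hn, hD]; ring
    linarith [sq_nonneg (2 * a - b - c)]
  have hn0 : 0 < n := by linarith
  have hGv : G = 8 + 4 * P + 4 * α + D * (3 + α) := by rw [hG, hL, hnS]; ring
  have hG0 : 0 ≤ G := by rw [hGv]; positivity
  have hQ := bridge_poly_nonneg ha hb hc hb1 hc1 hS hP hα hD
  have hr_le : r ≤ 2 + D / 4 := by
    refine (sq_le_sq₀ (by assumption) (by positivity)).1 ?_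
    rw [hr2]; linarith [sq_nonneg D]
  have hw_le : w ≤ n + 2 * D / n := by
    refine (sq_le_sq₀ (by assumption) (by positivity)).1 ?_
    have : (n + 2 * D / n) ^ 2 = n ^ 2 + 4 * D + (2 * D / n) ^ 2 := by field_simp; ring
    rw [this, hw2]; linarith [sq_nonneg (2 * D / n)]
  have hw_ge : n + 2 * D * n / (n ^ 2 + D) ≤ w := by
    refine (sq_le_sq₀ (by positivity) hw).1 ?_
    rw [hw2]
    have : n ^ 2 + 4 * D - (n + 2 * D * n / (n ^ 2 + D)) ^ 2
        = 4 * D ^ 3 / (n ^ 2 + D) ^ 2 := by field_simp; ring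
    have : 0 ≤ 4 * D ^ 3 / (n ^ 2 + D) ^ 2 := by positivity
    linarith
  have hwr : 0 < w + 2 * r := by
    have : 0 < w := lt_of_lt_of_le (by positivity) hw_ge
    positivity
  have hfrac : (w + 2 * r) * (1 - D / (2 * n)) ≤ 4 + n := by
    have h1 : 0 ≤ 1 - D / (2 * n) := by
      rw [sub_nonneg, div_le_one (by positivity)]; linarith
    have h2 : w + 2 * r ≤ (4 + n) * (1 + D / (2 * n)) := by
      have : (4 + n) * (1 + D / (2 * n)) = n + 2 * D / n + 2 * (2 + D / 4) := by
        field_simp; ring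
      linarith
    calc _ ≤ (4 + n) * (1 + D / (2 * n)) * (1 - D / (2 * n)) := by gcongr
      _ = (4 + n) - (4 + n) * (D / (2 * n)) ^ 2 := by ring
      _ ≤ _ := by have : 0 ≤ (4 + n) * (D / (2 * n)) ^ 2 := by positivity
                  linarith
  have hΨ : 0 ≤ 2 * (4 + D) * (2 * S + n - 8) - (4 + n) * L
      + (n + 2 * D * n / (n ^ 2 + D)) * G
      - 2 * S * (2 + D / 4) * (2 * S + 2 * n - 4) + 2 * S * G * (1 - D / (2 * n)) := by
    have e : n * (2 * (4 + D) * (2 * S + n - 8) - (4 + n) * L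
      + (n + 2 * D * n / (n ^ 2 + D)) * G
      - 2 * S * (2 + D / 4) * (2 * S + 2 * n - 4) + 2 * S * G * (1 - D / (2 * n)))
      = D * (n * (4 * S + 4 * P - 4 - S * P + S * α) + G * (2 * (n ^ 2 / (n ^ 2 + D)) - S)) := by
      have : 2 * D * n / (n ^ 2 + D) = D * 2 * (n ^ 2 / (n ^ 2 + D)) / n := by field_simp
      rw [this]
      generalize n ^ 2 / (n ^ 2 + D) = κ
      field_simp
      rw [hGv, hL, hnS]; ring
    have hκ : 1 - D / 14 ≤ n ^ 2 / (n ^ 2 + D) := by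
      rw [le_div_iff₀ (by positivity)]
      have hn2 : 0 ≤ n ^ 2 - 14 := by nlinarith
      have e2 : n ^ 2 - (1 - D / 14) * (n ^ 2 + D) = (D * (n ^ 2 - 14) + D ^ 2) / 14 := by ring
      linarith [mul_nonneg hD0 hn2, sq_nonneg D]
    have h3 : 0 ≤ n * (4 * S + 4 * P - 4 - S * P + S * α)
        + G * (2 * (n ^ 2 / (n ^ 2 + D)) - S) := by
      have h4 : G * (2 * (1 - D / 14) - S) ≤ G * (2 * (n ^ 2 / (n ^ 2 + D)) - S) := by gcongr
      have h5 : 0 ≤ D * ((1 - P - D) * (3 + α)) := by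
        have : 0 ≤ 1 - P - D := by linarith
        positivity
      have h6 : 0 ≤ D * (4 - P) := mul_nonneg hD0 (by linarith)
      have h7 : 0 ≤ D * (α * P) := by positivity
      have h8 : n * (4 * S + 4 * P - 4 - S * P + S * α) + G * (2 * (1 - D / 14) - S)
          = (12 * S + 20 * P + 4 * α - 8 * S * P + 4 * S * α + 4 * P ^ 2 + 4 * α * P - S * P ^ 2
            + S * α ^ 2 - 4 * S ^ 2 - S ^ 2 * α + S ^ 2 * P + D * (3 + α) * (9 / 7 - S))
            + (D * ((1 - P - D) * (3 + α)) + D * (4 - P) + D * (α * P)) / 7 := by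
        rw [hGv, hnS]; ring
      linarith
    have := mul_nonneg hD0 h3
    rw [← e] at this
    exact nonneg_of_mul_nonneg_right this hn0
  have hK : 0 ≤ 2 * S + 2 * n - 4 := by linarith
  have hΨ' : 2 * (4 + D) * (2 * S + n - 8) - (4 + n) * L
      + (n + 2 * D * n / (n ^ 2 + D)) * G
      - 2 * S * (2 + D / 4) * (2 * S + 2 * n - 4) + 2 * S * G * (1 - D / (2 * n)) ≤
      2 * (4 + D) * (2 * S + n - 8) - (4 + n) * L + w * G
      - 2 * S * r * (2 * S + 2 * n - 4) + 2 * S * G * (1 - D / (2 * n)) := by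
    gcongr
  have h9 := mul_nonneg hwr.le (hΨ.trans hΨ')
  have h10 := mul_le_mul_of_nonneg_left hfrac (by positivity : 0 ≤ 2 * S * G)
  linarith

end Algebra

section NlMean

lemma sqrt_four_add_sq_pos (d : ℝ) : 0 < √(4 + d ^ 2) := by positivity

lemma nlMean_comm (a b : ℝ) : nlMean a b = nlMean b a := by
  unfold nlMean
  rw [add_comm, show (a - b) ^ 2 = (b - a) ^ 2 by ring]

lemma nlMean_self (a : ℝ) : nlMean a a = a := by
  have : √(4 + (a - a) ^ 2) = 2 := by
    rw [show 4 + (a - a) ^ 2 = (2 : ℝ) ^ 2 by ring]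
    exact Real.sqrt_sq (by norm_num)
  unfold nlMean
  rw [this]; ring

lemma nlMean_sq (a b : ℝ) : nlMean a b ^ 2 = (a + b) ^ 2 / (4 + (a - b) ^ 2) := by
  unfold nlMean
  rw [div_pow, Real.sq_sqrt (by positivity)]

lemma nlMean_nonneg {a b : ℝ} (h : 0 ≤ a + b) : 0 ≤ nlMean a b := by
  unfold nlMean
  positivity

lemma nlMean_le_nlMean_of_sq {a b c d : ℝ} (h' : 0 ≤ c + d)
    (h : (a + b) ^ 2 * (1 - c * d) ≤ (c + d) ^ 2 * (1 - a * b)) :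
    nlMean a b ≤ nlMean c d := by
  refine le_of_sq_le_sq ?_ (nlMean_nonneg h')
  rw [nlMean_sq, nlMean_sq, div_le_div_iff₀ (by positivity) (by positivity)]
  linarith

lemma nlMean_le_nlMean_of {a b c d : ℝ} (h' : 0 ≤ c + d)
    (h : (1 - c * d) * (2 + (a ^ 2 + b ^ 2)) ≤ (1 - a * b) * (2 + (c ^ 2 + d ^ 2))) :
    nlMean a b ≤ nlMean c d :=
  nlMean_le_nlMean_of_sq h' (by linarith)

lemma nlMean_mono_left {a a' b : ℝ} (ha : 0 ≤ a) (haa' : a ≤ a') (ha' : a' ≤ 2) (hb : 0 ≤ b)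
    (hb' : b ≤ 2) : nlMean a b ≤ nlMean a' b := by
  apply nlMean_le_nlMean_of_sq (by linarith)
  have key : 0 ≤ (a' - a) * ((a + b) * (2 + b ^ 2 - a * b) + (a' - a) * (1 - a * b)) := by
    apply mul_nonneg (by linarith)
    have h1 : b * (a - b) ≤ 1 := by nlinarith [sq_nonneg (b - 1)]
    have h2 : 0 ≤ (a + b) * (1 - b * (a - b)) := mul_nonneg (by linarith) (by linarith)
    rcases le_total (a * b) 1 with h | h
    · have := mul_nonneg (sub_nonneg.2 haa') (sub_nonneg.2 h)
      nlinarith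
    · have h3 : (a' - a) * (a * b - 1) ≤ (2 - a) * (a * b - 1) := by
        apply mul_le_mul_of_nonneg_right <;> linarith
      have h4 : 0 ≤ a * b * (2 - b) := by
        have := sub_nonneg.2 hb'
        positivity
      nlinarith [mul_nonneg ha hb, mul_nonneg hb (sub_nonneg.2 hb'), mul_nonneg ha (sub_nonneg.2 (haa'.trans ha'))]
  linarith

lemma nlMean_mono {a a' b b' : ℝ} (ha : 0 ≤ a) (haa' : a ≤ a') (ha' : a' ≤ 2) (hb : 0 ≤ b)
    (hbb' : b ≤ b') (hb' : b' ≤ 2) : nlMean a b ≤ nlMean a' b' := by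
  refine (nlMean_mono_left ha haa' ha' hb (hbb'.trans hb')).trans ?_
  rw [nlMean_comm a', nlMean_comm a']
  exact nlMean_mono_left hb hbb' hb' (ha.trans haa') ha'

lemma nlMean_le_nlMean_zero {u v : ℝ} (hu : u ≤ 0) (huv : 0 ≤ u + v) :
    nlMean u v ≤ nlMean 0 v := by
  unfold nlMean
  have h : (0 - v) ^ 2 ≤ (u - v) ^ 2 := by nlinarith
  gcongr
  linarith

lemma nlMean_le_one {a b : ℝ} (h : a * b ≤ 1) : nlMean a b ≤ 1 := by
  refine le_of_sq_le_sq ?_ zero_le_one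
  rw [nlMean_sq, one_pow, div_le_one (by positivity)]
  linarith

lemma one_le_nlMean {a b : ℝ} (h0 : 0 ≤ a + b) (h : 1 ≤ a * b) : 1 ≤ nlMean a b := by
  refine le_of_sq_le_sq ?_ (nlMean_nonneg h0)
  rw [nlMean_sq, one_pow, one_le_div (by positivity)]
  linarith

/-- The Cantelli profile. -/
def tau (y : ℝ) : ℝ := y ^ 2 / (1 + y ^ 2)

lemma tau_nlMean_le (a b : ℝ) : tau (nlMean a b) ≤ (tau a + tau b) / 2 := by
  unfold tau
  rw [nlMean_sq]
  have e : (a + b) ^ 2 / (4 + (a - b) ^ 2) / (1 + (a + b) ^ 2 / (4 + (a - b) ^ 2))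
      = (a + b) ^ 2 / (4 + (a - b) ^ 2 + (a + b) ^ 2) := by field_simp
  rw [e, div_add_div _ _ (by positivity) (by positivity), div_div,
    div_le_div_iff₀ (by positivity) (by positivity)]
  nlinarith [mul_nonneg (sq_nonneg (a - b)) (sq_nonneg (1 - a * b))]

lemma tau_lt_one (y : ℝ) : tau y < 1 := by
  unfold tau
  rw [div_lt_one (by positivity)]; linarith

lemma tau_le_tau {x y : ℝ} (hx : 0 ≤ x) (hxy : x ≤ y) : tau x ≤ tau y := by
  unfold tau
  rw [div_le_div_iff₀ (by positivity) (by positivity)]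
  nlinarith [pow_le_pow_left₀ hx hxy 2]

lemma le_of_tau_le {x y : ℝ} (hy : 0 ≤ y) (h : tau x ≤ tau y) : x ≤ y := by
  unfold tau at h
  rw [div_le_div_iff₀ (by positivity) (by positivity)] at h
  refine le_of_sq_le_sq (by linarith) hy

lemma tau_sqrt {t : ℝ} (h0 : 0 ≤ t) (h1 : t < 1) : tau √(t / (1 - t)) = t := by
  have : 0 < 1 - t := by linarith
  unfold tau
  rw [Real.sq_sqrt (by positivity)]
  field_simp; ring

lemma tau_zero : tau 0 = 0 := by simp [tau]

lemma tau_one : tau 1 = 1 / 2 := by norm_num [tau]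

lemma nlMean_le_add {a b : ℝ} (ha : 0 ≤ a) (ha1 : a ≤ 1) (hb : 1 ≤ b) :
    nlMean a b ≤ nlMean a 1 + (b - 1) / 2 := by
  have h1 : nlMean a b ≤ (a + b) / √(4 + (a - 1) ^ 2) := by
    have h : (a - 1) ^ 2 ≤ (a - b) ^ 2 := by nlinarith
    unfold nlMean
    gcongr
  have h2 : (b - 1) / √(4 + (a - 1) ^ 2) ≤ (b - 1) / 2 := by
    have h : 2 ≤ √(4 + (a - 1) ^ 2) := by
      apply Real.le_sqrt_of_sq_le; linarith [sq_nonneg (a - 1)]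
    have : 0 ≤ b - 1 := by linarith
    gcongr
  have h3 : (a + b) / √(4 + (a - 1) ^ 2) = nlMean a 1 + (b - 1) / √(4 + (a - 1) ^ 2) := by
    unfold nlMean; ring
  linarith

lemma nlMean_le_avg {a b : ℝ} (h : 0 ≤ a + b) : nlMean a b ≤ (a + b) / 2 := by
  unfold nlMean
  gcongr
  apply Real.le_sqrt_of_sq_le; linarith [sq_nonneg (a - b)]

lemma le_nlMean_sub {a b : ℝ} (ha : 0 ≤ a) (hab : a ≤ b) (hb : b ≤ 1) :
    (b - a) / 2 - (b - a) ^ 2 / 8 ≤ nlMean a b - a := by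
  have h1 : √(4 + (a - b) ^ 2) * (1 - (a - b) ^ 2 / 8) ≤ 2 := by
    have h0 : √(4 + (a - b) ^ 2) ≤ 2 + (a - b) ^ 2 / 4 := by
      rw [Real.sqrt_le_left (by positivity)]
      nlinarith [sq_nonneg ((a - b) ^ 2)]
    have : 0 ≤ 1 - (a - b) ^ 2 / 8 := by nlinarith
    nlinarith [mul_le_mul_of_nonneg_right h0 this, sq_nonneg ((a - b) ^ 2)]
  have h2 : (a + b) / 2 * (1 - (a - b) ^ 2 / 8) ≤ nlMean a b := by
    unfold nlMean
    rw [le_div_iff₀ (by positivity)]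
    nlinarith
  nlinarith [sq_nonneg (a - b)]

lemma nlMean_shift {z a l : ℝ} (h : a ^ 2 < l) :
    nlMean ((z - a) / √(l - a ^ 2)) ((z + a) / √(l - a ^ 2)) = z / √l := by
  have h0 : 0 < l - a ^ 2 := by linarith
  have h1 : 0 < √(l - a ^ 2) := Real.sqrt_pos.2 h0
  have h2 : 0 < l := by nlinarith [sq_nonneg a]
  have h3 : 0 < √l := Real.sqrt_pos.2 h2
  have e : √(4 + ((z - a) / √(l - a ^ 2) - (z + a) / √(l - a ^ 2)) ^ 2)
      = 2 * √l / √(l - a ^ 2) := by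
    rw [Real.sqrt_eq_iff_mul_self_eq (by positivity) (by positivity)]
    have e1 := Real.sq_sqrt h0.le
    have e2 := Real.sq_sqrt h2.le
    field_simp
    rw [e1, e2]; ring
  unfold nlMean
  rw [e]; field_simp; ring

/-- `nlMean (nlMean a b) (nlMean a c) - nlMean a (nlMean b c)` has the sign of
`(a - b) * (a - c)`. -/
lemma exists_distrib_factor {a b c : ℝ} (ha : 0 ≤ a) (hb : 0 ≤ b) (hc : 0 ≤ c) (hb1 : b ≤ 1)
    (hc1 : c ≤ 1) : ∃ C : ℝ, 0 ≤ C ∧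
    (1 - a * nlMean b c) * (2 + (nlMean a b ^ 2 + nlMean a c ^ 2))
      - (1 - nlMean a b * nlMean a c) * (2 + (a ^ 2 + nlMean b c ^ 2))
      = (a - b) * (a - c) * C := by
  set r := √(4 + (b - c) ^ 2) with hrdef
  set R1 := √(4 + (a - b) ^ 2) with hR1def
  set R2 := √(4 + (a - c) ^ 2) with hR2def
  have hr : 0 < r := sqrt_four_add_sq_pos _
  have hR1 : 0 < R1 := sqrt_four_add_sq_pos _
  have hR2 : 0 < R2 := sqrt_four_add_sq_pos _
  have hr2 : r ^ 2 = 4 + (b - c) ^ 2 := Real.sq_sqrt (by positivity)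
  have hR12 : R1 ^ 2 = 4 + (a - b) ^ 2 := Real.sq_sqrt (by positivity)
  have hR22 : R2 ^ 2 = 4 + (a - c) ^ 2 := Real.sq_sqrt (by positivity)
  have hw2 : (R1 * R2) ^ 2 = (4 + (b - a) * (c - a)) ^ 2 + 4 * (b - c) ^ 2 := by
    rw [mul_pow, hR12, hR22]; ring
  have hΦ := distrib_defect_nonneg ha hb hc hb1 hc1 hr.le (mul_pos hR1 hR2).le rfl rfl rfl rfl rfl
    hr2 hw2 rfl rfl
  set w := R1 * R2 with hwdef
  have hw : 0 < w := mul_pos hR1 hR2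
  refine ⟨_, mul_nonneg hΦ (by positivity : 0 ≤ ((w + 2 * r) * (r ^ 2 * w ^ 2))⁻¹), ?_⟩
  rw [← div_eq_mul_inv, ← mul_div_assoc, eq_div_iff (by positivity)]
  have hY : r ^ 2 * (1 - a * nlMean b c) = r ^ 2 - a * (b + c) * r := by
    unfold nlMean; rw [← hrdef]; field_simp
  have hX : r ^ 2 * (2 + (a ^ 2 + nlMean b c ^ 2)) = 2 * r ^ 2 + a ^ 2 * r ^ 2 + (b + c) ^ 2 := by
    rw [nlMean_sq, ← hr2]; field_simp; ring
  have hY' : w ^ 2 * (1 - nlMean a b * nlMean a c) = w ^ 2 - (a + b) * (a + c) * w := by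
    unfold nlMean; rw [← hR1def, ← hR2def, hwdef]; field_simp
  have hX' : w ^ 2 * (2 + (nlMean a b ^ 2 + nlMean a c ^ 2))
      = 2 * w ^ 2 + (a + b) ^ 2 * (4 + (a - c) ^ 2) + (a + c) ^ 2 * (4 + (a - b) ^ 2) := by
    rw [nlMean_sq, nlMean_sq, ← hR12, ← hR22, hwdef]; field_simp; ring
  have e : ((1 - a * nlMean b c) * (2 + (nlMean a b ^ 2 + nlMean a c ^ 2))
      - (1 - nlMean a b * nlMean a c) * (2 + (a ^ 2 + nlMean b c ^ 2)))
      * ((w + 2 * r) * (r ^ 2 * w ^ 2))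
      = ((r ^ 2 * (1 - a * nlMean b c)) * (w ^ 2 * (2 + (nlMean a b ^ 2 + nlMean a c ^ 2)))
      - (w ^ 2 * (1 - nlMean a b * nlMean a c)) * (r ^ 2 * (2 + (a ^ 2 + nlMean b c ^ 2))))
      * (w + 2 * r) := by ring
  rw [e, hY, hX, hY', hX', hr2, hw2]
  clear_value r w
  linear_combination ((a + b) * (a + c) * (2 * (4 + (b - c) ^ 2) + a ^ 2 * (4 + (b - c) ^ 2)
    + (b + c) ^ 2) - (a - b) * (a - c) * (2 * (4 + (b - c) ^ 2) + (4 * (a * (b + c))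
    + 4 * (4 + (b - a) * (c - a)) - 16 + (b - c) ^ 2 * (1 + a ^ 2)))) * hw2
    + 2 * (-(a * (b + c)) * (2 * ((4 + (b - a) * (c - a)) ^ 2 + 4 * (b - c) ^ 2)
    + (a + b) ^ 2 * (4 + (a - c) ^ 2) + (a + c) ^ 2 * (4 + (a - b) ^ 2))
    + (a - b) * (a - c) * (2 * (a * (b + c)) * (2 * (a * (b + c))
    + 2 * (4 + (b - a) * (c - a)) - 4))) * hr2

lemma nlMean_distrib_le {a b c : ℝ} (ha : 0 ≤ a) (hb : 0 ≤ b) (hc : 0 ≤ c) (hb1 : b ≤ 1)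
    (hc1 : c ≤ 1) (h : 0 ≤ (a - b) * (a - c)) :
    nlMean a (nlMean b c) ≤ nlMean (nlMean a b) (nlMean a c) := by
  obtain ⟨C, hC, h1⟩ := exists_distrib_factor ha hb hc hb1 hc1
  have := mul_nonneg h hC
  have h2 := nlMean_nonneg (add_nonneg ha hb)
  have h3 := nlMean_nonneg (add_nonneg ha hc)
  exact nlMean_le_nlMean_of (by positivity) (by linarith)

lemma le_nlMean_distrib {a b c : ℝ} (ha : 0 ≤ a) (hb : 0 ≤ b) (hc : 0 ≤ c) (hb1 : b ≤ 1)
    (hc1 : c ≤ 1) (h : (a - b) * (a - c) ≤ 0) :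
    nlMean (nlMean a b) (nlMean a c) ≤ nlMean a (nlMean b c) := by
  obtain ⟨C, hC, h1⟩ := exists_distrib_factor ha hb hc hb1 hc1
  have := mul_nonneg (neg_nonneg.2 h) hC
  have h2 := nlMean_nonneg (add_nonneg hb hc)
  exact nlMean_le_nlMean_of (by positivity) (by linarith)

end NlMean

section Bridge

open Filter Topology

/-- The defining properties of the dyadic suspension bridge. -/
structure IsBridge (A : ℝ → ℝ) : Prop where
  cont : ContinuousOn A (Set.Icc 0 (1 / 2))
  zero : A 0 = 0
  half : A (1 / 2) = 1
  recur : ∀ n : ℕ, 2 ≤ n → ∀ k : ℕ, Odd k → k < 2 ^ (n - 1) →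
    A ((k : ℝ) / 2 ^ n) = nlMean (A (((k : ℝ) - 1) / 2 ^ n)) (A (((k : ℝ) + 1) / 2 ^ n))
  mono : StrictMonoOn A (Set.Icc 0 (1 / 2))

/-- The value of `A` at the `k`-th point of the dyadic grid of mesh `2^-(n+1)`. -/
def gridVal (A : ℝ → ℝ) (n k : ℕ) : ℝ := A ((k : ℝ) / 2 ^ (n + 1))

lemma grid_mem {n k : ℕ} (hk : k ≤ 2 ^ n) :
    (k : ℝ) / 2 ^ (n + 1) ∈ Set.Icc (0 : ℝ) (1 / 2) := by
  have : (k : ℝ) ≤ 2 ^ n := by exact_mod_cast hk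
  refine ⟨by positivity, ?_⟩
  rw [div_le_iff₀ (by positivity), pow_succ]
  linarith

lemma floor_grid_le {t : ℝ} (ht : t ∈ Set.Icc (0 : ℝ) (1 / 2)) (n : ℕ) :
    ⌊t * 2 ^ (n + 1)⌋₊ ≤ 2 ^ n := by
  apply Nat.floor_le_of_le
  push_cast
  rw [pow_succ]
  nlinarith [ht.2, pow_pos (two_pos : (0 : ℝ) < 2) n]

lemma tendsto_floor_grid {t : ℝ} (ht : 0 ≤ t) :
    Tendsto (fun n : ℕ => (⌊t * 2 ^ (n + 1)⌋₊ : ℝ) / 2 ^ (n + 1)) atTop (𝓝 t) :=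
  (tendsto_nat_floor_mul_div_atTop ht).comp
    ((tendsto_pow_atTop_atTop_of_one_lt (one_lt_two : (1 : ℝ) < 2)).comp (tendsto_add_atTop_nat 1))

lemma continuous_nlMean : Continuous (fun p : ℝ × ℝ => nlMean p.1 p.2) := by
  unfold nlMean
  refine Continuous.div (by fun_prop) (by fun_prop) fun p => (sqrt_four_add_sq_pos _).ne'

namespace IsBridge

variable {A : ℝ → ℝ} (h : IsBridge A)
include h

lemma mem_Icc {t : ℝ} (ht : t ∈ Set.Icc (0 : ℝ) (1 / 2)) : A t ∈ Set.Icc (0 : ℝ) 1 := by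
  constructor
  · rw [← h.zero]
    exact h.mono.monotoneOn ⟨le_rfl, by norm_num⟩ ht ht.1
  · rw [← h.half]
    exact h.mono.monotoneOn ht ⟨by norm_num, le_rfl⟩ ht.2

lemma gridVal_zero (n : ℕ) : gridVal A n 0 = 0 := by simp [gridVal, h.zero]

lemma gridVal_top (n : ℕ) : gridVal A n (2 ^ n) = 1 := by
  rw [← h.half]
  unfold gridVal
  congr 1
  push_cast; field_simp; ring

omit h in
lemma gridVal_even (n k : ℕ) : gridVal A (n + 1) (2 * k) = gridVal A n k := by
  unfold gridVal
  congr 1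
  push_cast; field_simp; ring

lemma gridVal_odd {n k : ℕ} (hk : k < 2 ^ n) :
    gridVal A (n + 1) (2 * k + 1) = nlMean (gridVal A n k) (gridVal A n (k + 1)) := by
  have := h.recur (n + 2) (by omega) (2 * k + 1) (odd_two_mul_add_one k)
    (by rw [show n + 2 - 1 = n + 1 by omega, pow_succ]; omega)
  unfold gridVal
  rw [this]
  congr 2
  · push_cast; field_simp; ring
  · push_cast; field_simp; ring

lemma gridVal_mem {n k : ℕ} (hk : k ≤ 2 ^ n) : gridVal A n k ∈ Set.Icc (0 : ℝ) 1 :=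
  h.mem_Icc (grid_mem hk)

lemma gridVal_mono {n i j : ℕ} (hij : i ≤ j) (hj : j ≤ 2 ^ n) :
    gridVal A n i ≤ gridVal A n j := by
  refine h.mono.monotoneOn (grid_mem (hij.trans hj)) (grid_mem hj) ?_
  have : (i : ℝ) ≤ j := by exact_mod_cast hij
  gcongr

lemma tendsto_of_mem {x : ℕ → ℝ} {t : ℝ} (hx : ∀ n, x n ∈ Set.Icc (0 : ℝ) (1 / 2))
    (hxt : Tendsto x atTop (𝓝 t)) : Tendsto (fun n => A (x n)) atTop (𝓝 (A t)) := by
  have ht : t ∈ Set.Icc (0 : ℝ) (1 / 2) :=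
    isClosed_Icc.mem_of_tendsto hxt (Eventually.of_forall hx)
  exact (h.cont t ht).tendsto.comp (tendsto_nhdsWithin_iff.2 ⟨hxt, Eventually.of_forall hx⟩)

lemma tendsto_gridVal {t : ℝ} (ht : t ∈ Set.Icc (0 : ℝ) (1 / 2)) :
    Tendsto (fun n => gridVal A n ⌊t * 2 ^ (n + 1)⌋₊) atTop (𝓝 (A t)) :=
  h.tendsto_of_mem (fun n => grid_mem (floor_grid_le ht n)) (tendsto_floor_grid ht.1)

lemma gridVal_adjacent (n : ℕ) : ∀ m, m + 2 ≤ 2 ^ n →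
    nlMean (gridVal A n m) (gridVal A n (m + 2)) ≤ gridVal A n (m + 1) := by
  induction n with
  | zero => intro m hm; simp at hm
  | succ n ih =>
    intro m hm
    rw [pow_succ] at hm
    rcases m.even_or_odd' with ⟨j, rfl | rfl⟩
    · rw [h.gridVal_odd (by omega), show 2 * j + 2 = 2 * (j + 1) by ring, gridVal_even,
        gridVal_even]
    · rw [show 2 * j + 1 + 1 = 2 * (j + 1) by ring,
        show 2 * j + 1 + 2 = 2 * (j + 1) + 1 by ring, gridVal_even, h.gridVal_odd (by omega),
        h.gridVal_odd (by omega)]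
      have h0 := h.gridVal_mem (n := n) (k := j) (by omega)
      have h1 := h.gridVal_mem (n := n) (k := j + 1) (by omega)
      have h2 := h.gridVal_mem (n := n) (k := j + 1 + 1) (by omega)
      have h01 := h.gridVal_mono (n := n) (i := j) (j := j + 1) (by omega) (by omega)
      have h12 := h.gridVal_mono (n := n) (i := j + 1) (j := j + 1 + 1) (by omega) (by omega)
      have h3 := ih j (by omega)
      rw [nlMean_comm (gridVal A n j) (gridVal A n (j + 1))]
      refine (le_nlMean_distrib h1.1 h0.1 h2.1 h0.2 h2.2 ?_).trans ?_
      · exact mul_nonpos_of_nonneg_of_nonpos (by linarith) (by linarith)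
      · have h4 : 0 ≤ nlMean (gridVal A n j) (gridVal A n (j + 1 + 1)) :=
          nlMean_nonneg (add_nonneg h0.1 h2.1)
        calc _ ≤ nlMean (gridVal A n (j + 1)) (gridVal A n (j + 1)) :=
              nlMean_mono h1.1 le_rfl (by linarith [h1.2]) h4 h3 (by linarith [h1.2])
          _ = _ := nlMean_self _

lemma gridVal_sub_mul_sub_nonneg {n i j k : ℕ} (hi : i ≤ 2 ^ n) (hjk : j ≤ k) (hk : k ≤ 2 ^ n)
    (hijk : i ≤ j ∨ k ≤ i) :
    0 ≤ (gridVal A n i - gridVal A n j) * (gridVal A n i - gridVal A n k) := by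
  have h1 := h.gridVal_mono hjk hk
  rcases hijk with h2 | h2
  · have := h.gridVal_mono h2 (hjk.trans hk)
    exact mul_nonneg_of_nonpos_of_nonpos (by linarith) (by linarith)
  · have := h.gridVal_mono h2 hi
    exact mul_nonneg (by linarith) (by linarith)

lemma nlMean_gridVal_le (n : ℕ) : ∀ i j, i ≤ 2 ^ n → j ≤ 2 ^ n →
    nlMean (gridVal A n i) (gridVal A n j) ≤ gridVal A (n + 1) (i + j) := by
  induction n with
  | zero =>
    have h01 : nlMean (gridVal A 0 0) (gridVal A 0 1) ≤ gridVal A 1 1 :=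
      (h.gridVal_odd (n := 0) (k := 0) (by norm_num)).ge
    intro i j hi hj
    have hi' : i = 0 ∨ i = 1 := by rw [pow_zero] at hi; omega
    have hj' : j = 0 ∨ j = 1 := by rw [pow_zero] at hj; omega
    rcases hi' with rfl | rfl <;> rcases hj' with rfl | rfl
    · rw [nlMean_self]; exact (gridVal_even 0 0).ge
    · exact h01
    · rw [nlMean_comm]; exact h01
    · rw [nlMean_self]; exact (gridVal_even 0 1).ge
  | succ n ih =>
    have mixed : ∀ i j, i ≤ 2 ^ n → j < 2 ^ n →
        nlMean (gridVal A (n + 1) (2 * i)) (gridVal A (n + 1) (2 * j + 1)) ≤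
          gridVal A (n + 2) (2 * (i + j) + 1) := by
      intro i j hi hj
      rw [gridVal_even, h.gridVal_odd hj, h.gridVal_odd (by rw [pow_succ]; omega)]
      have hi0 := h.gridVal_mem hi
      have hj0 := h.gridVal_mem hj.le
      have hj1 := h.gridVal_mem (n := n) (k := j + 1) hj
      refine (nlMean_distrib_le hi0.1 hj0.1 hj1.1 hj0.2 hj1.2
        (h.gridVal_sub_mul_sub_nonneg hi (by omega) hj (by omega))).trans ?_
      have hk : i + j + 1 ≤ 2 ^ (n + 1) := by rw [pow_succ]; omega
      refine nlMean_mono (nlMean_nonneg (add_nonneg hi0.1 hj0.1)) (ih i j hi hj.le) ?_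
        (nlMean_nonneg (add_nonneg hi0.1 hj1.1)) (ih i (j + 1) hi hj) ?_
      · linarith [(h.gridVal_mem (n := n + 1) (k := i + j) (by omega)).2]
      · have := (h.gridVal_mem hk).2
        linarith
    intro i j hi hj
    rw [pow_succ] at hi hj
    rcases i.even_or_odd' with ⟨i, rfl | rfl⟩ <;> rcases j.even_or_odd' with ⟨j, rfl | rfl⟩
    · rw [gridVal_even, gridVal_even, ← mul_add, gridVal_even]
      exact ih i j (by omega) (by omega)
    · rw [show 2 * i + (2 * j + 1) = 2 * (i + j) + 1 by ring]
      exact mixed i j (by omega) (by omega)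
    · rw [nlMean_comm, show 2 * i + 1 + 2 * j = 2 * (j + i) + 1 by ring]
      exact mixed j i (by omega) (by omega)
    · rcases eq_or_ne i j with rfl | hne
      · rw [nlMean_self, ← two_mul, gridVal_even]
      · have hi' : 2 * i + 1 ≤ 2 ^ (n + 1) := by rw [pow_succ]; omega
        have hj' : 2 * (j + 1) ≤ 2 ^ (n + 1) := by rw [pow_succ]; omega
        have hm0 := mixed j i (by omega) (by omega)
        have hm1 := mixed (j + 1) i (by omega) (by omega)
        rw [nlMean_comm, show 2 * (j + i) + 1 = 2 * (i + j) + 1 by ring] at hm0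
        rw [nlMean_comm, show 2 * (j + 1 + i) + 1 = 2 * (i + j) + 1 + 2 by ring] at hm1
        have hadj := h.gridVal_adjacent (n + 2) (2 * (i + j) + 1) (by
          rw [pow_succ, pow_succ]; omega)
        have hi0 := h.gridVal_mem hi'
        have hj0 := h.gridVal_mem (n := n + 1) (k := 2 * j) (by omega)
        have hj1 := h.gridVal_mem hj'
        rw [show 2 * i + 1 + (2 * j + 1) = 2 * (i + j) + 1 + 1 by ring]
        refine le_trans ?_ hadj
        rw [h.gridVal_odd (n := n) (k := j) (by omega), ← gridVal_even n j,
          ← gridVal_even n (j + 1)]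
        refine (nlMean_distrib_le hi0.1 hj0.1 hj1.1 hj0.2 hj1.2
          (h.gridVal_sub_mul_sub_nonneg hi' (by omega) hj' (by omega))).trans ?_
        have hk : 2 * (i + j) + 1 + 2 ≤ 2 ^ (n + 2) := by rw [pow_succ, pow_succ]; omega
        refine nlMean_mono (nlMean_nonneg (add_nonneg hi0.1 hj0.1)) hm0 ?_
          (nlMean_nonneg (add_nonneg hi0.1 hj1.1)) hm1 ?_
        · linarith [(h.gridVal_mem (n := n + 2) (k := 2 * (i + j) + 1) (by omega)).2]
        · linarith [(h.gridVal_mem hk).2]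

lemma nlMean_le_mid {s t : ℝ} (hs : s ∈ Set.Icc (0 : ℝ) (1 / 2))
    (ht : t ∈ Set.Icc (0 : ℝ) (1 / 2)) : nlMean (A s) (A t) ≤ A ((s + t) / 2) := by
  have e : ∀ n : ℕ, ((⌊s * 2 ^ (n + 1)⌋₊ + ⌊t * 2 ^ (n + 1)⌋₊ : ℕ) : ℝ) / 2 ^ (n + 1 + 1)
      = ((⌊s * 2 ^ (n + 1)⌋₊ : ℝ) / 2 ^ (n + 1) + (⌊t * 2 ^ (n + 1)⌋₊ : ℝ) / 2 ^ (n + 1)) / 2 := by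
    intro n; push_cast; field_simp; ring
  have h1 := continuous_nlMean.continuousAt.tendsto.comp
    ((h.tendsto_gridVal hs).prodMk_nhds (h.tendsto_gridVal ht))
  have h2 : Tendsto (fun n => gridVal A (n + 1) (⌊s * 2 ^ (n + 1)⌋₊ + ⌊t * 2 ^ (n + 1)⌋₊))
      atTop (𝓝 (A ((s + t) / 2))) := by
    refine h.tendsto_of_mem (fun n => grid_mem ?_) ?_
    · have := floor_grid_le hs n
      have := floor_grid_le ht n
      have : 2 ^ (n + 1) = 2 ^ n * 2 := pow_succ 2 n
      omega
    · simp_rw [e]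
      exact ((tendsto_floor_grid hs.1).add (tendsto_floor_grid ht.1)).div_const 2
  exact le_of_tendsto_of_tendsto' h1 h2 fun n =>
    h.nlMean_gridVal_le n _ _ (floor_grid_le hs n) (floor_grid_le ht n)

lemma tau_gridVal_le (n : ℕ) : ∀ k, k ≤ 2 ^ n → tau (gridVal A n k) ≤ (k : ℝ) / 2 ^ (n + 1) := by
  induction n with
  | zero =>
    intro k hk
    have hk' : k = 0 ∨ k = 1 := by rw [pow_zero] at hk; omega
    rcases hk' with rfl | rfl
    · rw [h.gridVal_zero, tau_zero]; simp
    · rw [show gridVal A 0 1 = 1 from h.gridVal_top 0, tau_one]; norm_num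
  | succ n ih =>
    intro k hk
    rw [pow_succ] at hk
    rcases k.even_or_odd' with ⟨j, rfl | rfl⟩
    · rw [gridVal_even]
      refine (ih j (by omega)).trans_eq ?_
      push_cast; field_simp; ring
    · rw [h.gridVal_odd (by omega)]
      refine (tau_nlMean_le _ _).trans ?_
      have h1 := ih j (by omega)
      have h2 := ih (j + 1) (by omega)
      have : ((2 * j + 1 : ℕ) : ℝ) / 2 ^ (n + 1 + 1)
          = ((j : ℝ) / 2 ^ (n + 1) + ((j + 1 : ℕ) : ℝ) / 2 ^ (n + 1)) / 2 := by
        push_cast; field_simp; ring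
      linarith

omit h in
lemma continuous_tau : Continuous tau := by
  unfold tau
  refine Continuous.div (by fun_prop) (by fun_prop) fun y => by positivity

lemma tau_le {t : ℝ} (ht : t ∈ Set.Icc (0 : ℝ) (1 / 2)) : tau (A t) ≤ t :=
  le_of_tendsto_of_tendsto' (continuous_tau.continuousAt.tendsto.comp (h.tendsto_gridVal ht))
    (tendsto_floor_grid ht.1) fun n => h.tau_gridVal_le n _ (floor_grid_le ht n)

end IsBridge

end Bridge

section BridgeMixed

open Filter Topology

/-- An explicit minorant of the inverse bridge on `[1/4, 1/2]`. -/
def vhat (x : ℝ) : ℝ := 2 * x ^ 2 / (1 + 3 * x ^ 2)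

lemma vhat_nlMean (a b : ℝ) : vhat (nlMean a b)
    = (a + b) ^ 2 / (2 * (1 + a ^ 2 + b ^ 2 + a * b)) := by
  have h0 : 0 < 1 + a ^ 2 + b ^ 2 + a * b := by nlinarith [sq_nonneg (a + b)]
  unfold vhat
  rw [nlMean_sq]
  have e : 1 + 3 * ((a + b) ^ 2 / (4 + (a - b) ^ 2))
      = 4 * (1 + a ^ 2 + b ^ 2 + a * b) / (4 + (a - b) ^ 2) := by
    field_simp; ring
  rw [e]
  field_simp; ring

lemma le_vhat_nlMean {a b : ℝ} (h : 1 / 5 ≤ a * b) (h' : a * b ≤ 1) :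
    (vhat a + vhat b) / 2 ≤ vhat (nlMean a b) := by
  have h0 : 0 < 1 + a ^ 2 + b ^ 2 + a * b := by nlinarith [sq_nonneg (a + b)]
  rw [vhat_nlMean]
  unfold vhat
  rw [div_add_div _ _ (by positivity) (by positivity), div_div,
    div_le_div_iff₀ (by positivity) (by positivity)]
  have h1 : 0 ≤ 8 * (a * b) + (a - b) ^ 2 - 1 - 3 * (a * b) ^ 2 := by nlinarith [sq_nonneg (a - b)]
  nlinarith [mul_nonneg (sq_nonneg (a - b)) h1]

lemma le_of_vhat_le {x y : ℝ} (hy : 0 ≤ y) (h : vhat x ≤ vhat y) : x ≤ y := by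
  unfold vhat at h
  rw [div_le_div_iff₀ (by positivity) (by positivity)] at h
  exact le_of_sq_le_sq (by linarith) hy

lemma vhat_nlMean_zero (b : ℝ) : vhat (nlMean 0 b) = tau b / 2 := by
  rw [vhat_nlMean]
  unfold tau
  rw [div_div]
  congr 1 <;> ring

lemma continuous_vhat : Continuous vhat := by
  unfold vhat
  refine Continuous.div (by fun_prop) (by fun_prop) fun y => by positivity

namespace IsBridge

variable {A : ℝ → ℝ} (h : IsBridge A)
include h

lemma gridVal_one_one_sq : gridVal A 1 1 ^ 2 = 1 / 5 := by
  have := h.gridVal_odd (n := 0) (k := 0) (by norm_num)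
  simp only [mul_zero, zero_add] at this
  rw [this, nlMean_sq, h.gridVal_zero, show gridVal A 0 1 = 1 from h.gridVal_top 0]
  norm_num

omit h in
lemma gridVal_pow_mul (n m k : ℕ) : gridVal A (n + m) (2 ^ m * k) = gridVal A n k := by
  unfold gridVal
  congr 1
  push_cast; field_simp; ring

lemma gridVal_one_one_le {n k : ℕ} (hk : 2 ^ n ≤ 2 * k) (hk' : k ≤ 2 ^ n) (hn : 1 ≤ n) :
    gridVal A 1 1 ≤ gridVal A n k := by
  obtain ⟨m, rfl⟩ := Nat.exists_eq_add_of_le hn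
  rw [← gridVal_pow_mul 1 m 1]
  refine h.gridVal_mono ?_ hk'
  rw [pow_add] at hk
  omega

lemma le_vhat_gridVal (n : ℕ) : ∀ k : ℕ, 2 ^ n ≤ 2 * k → k ≤ 2 ^ n →
    (k : ℝ) / 2 ^ (n + 1) ≤ vhat (gridVal A n k) := by
  induction n with
  | zero =>
    intro k hk hk'
    rw [pow_zero] at hk hk'
    obtain rfl : k = 1 := by omega
    rw [show gridVal A 0 1 = 1 from h.gridVal_top 0]
    norm_num [vhat]
  | succ n ih =>
    intro k hk hk'
    rw [pow_succ] at hk hk'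
    rcases k.even_or_odd' with ⟨j, rfl | rfl⟩
    · rw [IsBridge.gridVal_even]
      refine Eq.trans_le ?_ (ih j (by omega) (by omega))
      push_cast; field_simp; ring
    · rcases n with _ | n
      · obtain rfl : j = 0 := by simp at hk'; omega
        have := h.gridVal_one_one_sq
        norm_num [vhat, this]
      · have h2 : 2 ^ (n + 1) = 2 * 2 ^ n := by ring
        rw [h.gridVal_odd (by omega)]
        have h3 := h.gridVal_one_one_le (n := n + 1) (k := j) (by omega) (by omega) (by omega)
        have h4 := h.gridVal_one_one_le (n := n + 1) (k := j + 1) (by omega) (by omega) (by omega)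
        have h5 := h.gridVal_mem (n := n + 1) (k := j) (by omega)
        have h6 := h.gridVal_mem (n := n + 1) (k := j + 1) (by omega)
        have h7 := (h.gridVal_mem (n := 1) (k := 1) (by norm_num)).1
        refine le_trans ?_ (le_vhat_nlMean ?_ ?_)
        · have h8 := ih j (by omega) (by omega)
          have h9 := ih (j + 1) (by omega) (by omega)
          have : ((2 * j + 1 : ℕ) : ℝ) / 2 ^ (n + 1 + 1 + 1)
              = ((j : ℝ) / 2 ^ (n + 1 + 1) + ((j + 1 : ℕ) : ℝ) / 2 ^ (n + 1 + 1)) / 2 := by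
            push_cast; field_simp; ring
          linarith
        · rw [← h.gridVal_one_one_sq, sq]
          exact mul_le_mul h3 h4 h7 h5.1
        · exact mul_le_one₀ h5.2 h6.1 h6.2

lemma le_vhat {t : ℝ} (ht : t ∈ Set.Icc (1 / 4 : ℝ) (1 / 2)) : t ≤ vhat (A t) := by
  have ht' : t ∈ Set.Icc (0 : ℝ) (1 / 2) := ⟨by linarith [ht.1], ht.2⟩
  refine le_of_tendsto_of_tendsto (tendsto_floor_grid ht'.1)
    (continuous_vhat.continuousAt.tendsto.comp (h.tendsto_gridVal ht'))
    ((eventually_ge_atTop 1).mono fun n hn => h.le_vhat_gridVal n _ ?_ (floor_grid_le ht' n))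
  obtain ⟨m, rfl⟩ := Nat.exists_eq_add_of_le' hn
  have : 2 ^ m ≤ ⌊t * 2 ^ (m + 1 + 1)⌋₊ := by
    apply Nat.le_floor
    push_cast
    have : (0 : ℝ) < 2 ^ m := by positivity
    rw [pow_succ, pow_succ]
    nlinarith [ht.1]
  rw [pow_succ]; omega

lemma gridVal_two_three_le : gridVal A 2 3 ≤ 0.698 := by
  have h1 := h.gridVal_odd (n := 1) (k := 1) (by norm_num)
  have h2 := h.gridVal_one_one_sq
  have h3 := (h.gridVal_mem (n := 1) (k := 1) (by norm_num)).1
  have h4 : gridVal A 1 (1 + 1) = 1 := h.gridVal_top 1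
  rw [h4] at h1
  rw [show gridVal A 2 3 = _ from h1]
  refine le_of_sq_le_sq ?_ (by norm_num)
  rw [nlMean_sq, div_le_iff₀ (by positivity)]
  nlinarith

lemma gridVal_increment (n : ℕ) (hn : 2 ≤ n) : ∀ k, 3 * 2 ^ n ≤ 4 * k → k < 2 ^ n →
    (gridVal A n (k + 1) - gridVal A n k)⁻¹ + 0.6 ≤ 2 ^ n * 0.979 := by
  induction n, hn using Nat.le_induction with
  | base =>
    intro k hk hk'
    obtain rfl : k = 3 := by omega
    have h4 : gridVal A 2 (3 + 1) = 1 := h.gridVal_top 2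
    have h5 := h.gridVal_two_three_le
    rw [h4]
    have : (1 - gridVal A 2 3)⁻¹ ≤ 0.302⁻¹ := by
      gcongr
      linarith
    refine (add_le_add_left this _).trans ?_
    norm_num
  | succ n hn ih =>
    intro k hk hk'
    rw [pow_succ] at hk hk'
    obtain ⟨m, rfl⟩ := Nat.exists_eq_add_of_le' hn
    have h2 : 2 ^ (m + 2) = 4 * 2 ^ m := by ring
    obtain ⟨j, hj⟩ : ∃ j, k = 2 * j ∨ k = 2 * j + 1 := k.even_or_odd'
    have hj1 : 3 * 2 ^ (m + 2) ≤ 4 * j := by omega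
    have hj2 : j < 2 ^ (m + 2) := by omega
    have h3 := ih j hj1 hj2
    have h4 := h.gridVal_mem (n := m + 2) (k := j) hj2.le
    have h5 := h.gridVal_mem (n := m + 2) (k := j + 1) hj2
    have h6 : gridVal A (m + 2) j < gridVal A (m + 2) (j + 1) := by
      refine h.mono (grid_mem hj2.le) (grid_mem hj2) ?_
      push_cast
      gcongr
      linarith
    have h7 := h.gridVal_one_one_le (n := m + 2) (k := j) (by omega) hj2.le (by omega)
    have h8 : 0.4 ≤ gridVal A 1 1 := by
      refine le_of_sq_le_sq ?_ (h.gridVal_mem (n := 1) (k := 1) (by norm_num)).1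
      rw [h.gridVal_one_one_sq]; norm_num
    set a := gridVal A (m + 2) j
    set b := gridVal A (m + 2) (j + 1)
    have hd : 0 < b - a := by linarith
    have hd' : b - a ≤ 0.6 := by linarith [h5.2]
    rw [pow_succ]
    rcases hj with rfl | rfl
    · rw [h.gridVal_odd hj2, gridVal_even]
      have h9 := le_nlMean_sub h4.1 h6.le h5.2
      have h10 : (nlMean a b - a)⁻¹ ≤ ((b - a) / 2 - (b - a) ^ 2 / 8)⁻¹ := by
        have : 0 < (b - a) / 2 - (b - a) ^ 2 / 8 := by nlinarith
        gcongr
      have h11 : ((b - a) / 2 - (b - a) ^ 2 / 8)⁻¹ ≤ 2 * (b - a)⁻¹ + 0.6 := by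
        generalize b - a = d at *
        have h12 : 0 < 4 - d := by linarith
        have h13 : (d / 2 - d ^ 2 / 8)⁻¹ = 2 * d⁻¹ + 2 * (4 - d)⁻¹ := by
          rw [show d / 2 - d ^ 2 / 8 = d * (4 - d) / 8 by ring]
          field_simp; ring
        have h14 : (4 - d)⁻¹ ≤ 3.4⁻¹ := by
          gcongr
          linarith
        rw [h13]
        norm_num at h14 ⊢
        linarith
      linarith
    · rw [show 2 * j + 1 + 1 = 2 * (j + 1) by ring, h.gridVal_odd hj2, gridVal_even]
      have h9 := nlMean_le_avg (a := a) (b := b) (by linarith)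
      have h10 : (b - nlMean a b)⁻¹ ≤ ((b - a) / 2)⁻¹ := by
        gcongr
        linarith
      rw [inv_div, div_eq_mul_inv] at h10
      linarith

lemma gridVal_slope {n : ℕ} (hn : 2 ≤ n) {i : ℕ} (hi : 3 * 2 ^ n ≤ 4 * i) (m : ℕ)
    (hm : i + m ≤ 2 ^ n) :
    2.04 * ((m : ℝ) / 2 ^ (n + 1)) ≤ gridVal A n (i + m) - gridVal A n i := by
  induction m with
  | zero => simp
  | succ m ih =>
    have h1 := ih (by omega)
    have h2 := h.gridVal_increment n hn (i + m) (by omega) (by omega)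
    have h6 : gridVal A n (i + m) < gridVal A n (i + m + 1) := by
      refine h.mono (grid_mem (by omega)) (grid_mem (by omega)) ?_
      have : ((i + m : ℕ) : ℝ) < ((i + m + 1 : ℕ) : ℝ) := by exact_mod_cast Nat.lt_succ_self _
      gcongr
    have h3 : (gridVal A n (i + m + 1) - gridVal A n (i + m))⁻¹ ≤ 2 ^ n * 0.979 := by linarith
    rw [inv_le_comm₀ (by linarith) (by positivity), mul_inv] at h3
    have h4 : 2.04 * (((m + 1 : ℕ) : ℝ) / 2 ^ (n + 1))
        = 2.04 * ((m : ℝ) / 2 ^ (n + 1)) + 1.02 * (2 ^ n)⁻¹ := by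
      push_cast; rw [pow_succ]; field_simp; ring
    have h5 : (1.02 : ℝ) * (2 ^ n)⁻¹ ≤ (2 ^ n)⁻¹ * 0.979⁻¹ := by
      rw [mul_comm]
      gcongr
      norm_num
    rw [h4, ← add_assoc]
    linarith

lemma slope {x y : ℝ} (hx : 3 / 8 ≤ x) (hxy : x ≤ y) (hy : y ≤ 1 / 2) :
    2.04 * (y - x) ≤ A y - A x := by
  have hx' : x ∈ Set.Icc (0 : ℝ) (1 / 2) := ⟨by linarith, by linarith⟩
  have hy' : y ∈ Set.Icc (0 : ℝ) (1 / 2) := ⟨by linarith, by linarith⟩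
  refine le_of_tendsto_of_tendsto
    (((tendsto_floor_grid hy'.1).sub (tendsto_floor_grid hx'.1)).const_mul 2.04)
    ((h.tendsto_gridVal hy').sub (h.tendsto_gridVal hx'))
    ((eventually_ge_atTop 2).mono fun n hn => ?_)
  have h1 : ⌊x * 2 ^ (n + 1)⌋₊ ≤ ⌊y * 2 ^ (n + 1)⌋₊ := by gcongr
  have h2 := floor_grid_le hy' n
  obtain ⟨m, hm⟩ := Nat.exists_eq_add_of_le h1
  have h3 : 3 * 2 ^ n ≤ 4 * ⌊x * 2 ^ (n + 1)⌋₊ := by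
    obtain ⟨l, rfl⟩ := Nat.exists_eq_add_of_le' hn
    have : 3 * 2 ^ l ≤ ⌊x * 2 ^ (l + 2 + 1)⌋₊ := by
      apply Nat.le_floor
      push_cast
      have : (0 : ℝ) < 2 ^ l := by positivity
      rw [pow_succ, pow_succ, pow_succ]
      nlinarith
    rw [pow_add]; omega
  have h4 := h.gridVal_slope hn h3 m (by omega)
  simp only [hm]
  refine Eq.trans_le ?_ h4
  push_cast; ring

/-- The midpoint inequality for one argument beyond the end of the bridge. -/
def MixedAt (A : ℝ → ℝ) (b s : ℝ) : Prop := nlMean (A s) b ≤ A ((s + tau b) / 2)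

omit h in
lemma half_le_tau {b : ℝ} (hb : 1 ≤ b) : 1 / 2 ≤ tau b := by
  rw [← tau_one]; exact tau_le_tau zero_le_one hb

lemma mixedAt_of_step {b : ℝ} (hb : 1 ≤ b)
    (step : ∀ n j : ℕ, j < 2 ^ n → ((2 * j + 1 : ℕ) : ℝ) / 2 ^ (n + 1 + 1) + tau b ≤ 1 →
      MixedAt A b ((j : ℝ) / 2 ^ (n + 1)) →
      (((j + 1 : ℕ) : ℝ) / 2 ^ (n + 1) + tau b ≤ 1 →
        MixedAt A b (((j + 1 : ℕ) : ℝ) / 2 ^ (n + 1))) →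
      MixedAt A b (((2 * j + 1 : ℕ) : ℝ) / 2 ^ (n + 1 + 1)))
    {s : ℝ} (hs : s ∈ Set.Icc (0 : ℝ) (1 / 2)) (hsb : s + tau b ≤ 1) : MixedAt A b s := by
  have htb := half_le_tau hb
  have hgrid : ∀ n k : ℕ, k ≤ 2 ^ n → (k : ℝ) / 2 ^ (n + 1) + tau b ≤ 1 →
      MixedAt A b ((k : ℝ) / 2 ^ (n + 1)) := by
    intro n
    induction n with
    | zero =>
      intro k hk hkb
      have hk' : k = 0 ∨ k = 1 := by rw [pow_zero] at hk; omega
      rcases hk' with rfl | rfl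
      · unfold MixedAt
        simp only [Nat.cast_zero, zero_div, zero_add, h.zero] at hkb ⊢
        have ht : tau b / 2 ∈ Set.Icc (1 / 4 : ℝ) (1 / 2) := ⟨by linarith, by linarith⟩
        refine le_of_vhat_le (h.mem_Icc ⟨by linarith [ht.1], ht.2⟩).1 ?_
        rw [vhat_nlMean_zero]
        exact h.le_vhat ht
      · norm_num at hkb
        have hb1 : b = 1 := le_antisymm (le_of_tau_le zero_le_one (by rw [tau_one]; linarith)) hb
        unfold MixedAt
        rw [hb1, tau_one]
        norm_num
        rw [h.half, nlMean_self]
    | succ n ih =>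
      intro k hk hkb
      rw [pow_succ] at hk
      rcases k.even_or_odd' with ⟨j, rfl | rfl⟩
      · have e : ((2 * j : ℕ) : ℝ) / 2 ^ (n + 1 + 1) = (j : ℝ) / 2 ^ (n + 1) := by
          push_cast; field_simp; ring
        rw [e] at hkb ⊢
        exact ih j (by omega) hkb
      · refine step n j (by omega) hkb (ih j (by omega) ?_) (ih (j + 1) (by omega))
        suffices (j : ℝ) / 2 ^ (n + 1) ≤ ((2 * j + 1 : ℕ) : ℝ) / 2 ^ (n + 1 + 1) by linarith
        rw [div_le_div_iff₀ (by positivity) (by positivity)]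
        push_cast
        rw [pow_succ (2 : ℝ) (n + 1)]
        have : (0 : ℝ) < 2 ^ (n + 1) := by positivity
        nlinarith
  have hle : ∀ n : ℕ, (⌊s * 2 ^ (n + 1)⌋₊ : ℝ) / 2 ^ (n + 1) ≤ s := fun n => by
    rw [div_le_iff₀ (by positivity)]
    exact Nat.floor_le (by have := hs.1; positivity)
  have h1 := continuous_nlMean.continuousAt.tendsto.comp
    ((h.tendsto_gridVal hs).prodMk_nhds (tendsto_const_nhds (x := b)))
  have h2 : Tendsto (fun n : ℕ => A (((⌊s * 2 ^ (n + 1)⌋₊ : ℝ) / 2 ^ (n + 1) + tau b) / 2))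
      atTop (𝓝 (A ((s + tau b) / 2))) := by
    refine h.tendsto_of_mem (fun n => ?_)
      (((tendsto_floor_grid hs.1).add tendsto_const_nhds).div_const 2)
    have := hle n
    have : 0 ≤ (⌊s * 2 ^ (n + 1)⌋₊ : ℝ) / 2 ^ (n + 1) := by positivity
    constructor <;> linarith
  exact le_of_tendsto_of_tendsto' h1 h2 fun n =>
    hgrid n _ (floor_grid_le hs n) (by linarith [hle n])

omit h in
lemma grid_mid (n j : ℕ) : ((2 * j + 1 : ℕ) : ℝ) / 2 ^ (n + 1 + 1)
    = ((j : ℝ) / 2 ^ (n + 1) + ((j + 1 : ℕ) : ℝ) / 2 ^ (n + 1)) / 2 := by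
  push_cast; field_simp; ring

lemma nlMean_grid_mid_le {b : ℝ} (hb : 1 ≤ b) {n j : ℕ} (hj : j < 2 ^ n) {z₁ z₂ : ℝ}
    (h1 : nlMean (A ((j : ℝ) / 2 ^ (n + 1))) b ≤ z₁)
    (h2 : nlMean (A (((j + 1 : ℕ) : ℝ) / 2 ^ (n + 1))) b ≤ z₂) (hz₁ : z₁ ≤ 2) (hz₂ : z₂ ≤ 2) :
    nlMean (A (((2 * j + 1 : ℕ) : ℝ) / 2 ^ (n + 1 + 1))) b ≤ nlMean z₁ z₂ := by
  have e := h.gridVal_odd hj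
  unfold gridVal at e
  have h3 := h.mem_Icc (grid_mem hj.le)
  have h4 := h.mem_Icc (grid_mem (n := n) (k := j + 1) hj)
  rw [e, nlMean_comm]
  rw [nlMean_comm] at h1 h2
  refine (nlMean_distrib_le (by linarith) h3.1 h4.1 h3.2 h4.2
    (mul_nonneg (by linarith [h3.2]) (by linarith [h4.2]))).trans ?_
  exact nlMean_mono (nlMean_nonneg (by linarith [h3.1])) h1 hz₁
    (nlMean_nonneg (by linarith [h4.1])) h2 hz₂

lemma mixedAt_mid {b : ℝ} (hb : 1 ≤ b) {n j : ℕ} (hj : j < 2 ^ n)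
    (h1 : MixedAt A b ((j : ℝ) / 2 ^ (n + 1)))
    (h2 : MixedAt A b (((j + 1 : ℕ) : ℝ) / 2 ^ (n + 1)))
    (h3 : ((j + 1 : ℕ) : ℝ) / 2 ^ (n + 1) + tau b ≤ 1) :
    MixedAt A b (((2 * j + 1 : ℕ) : ℝ) / 2 ^ (n + 1 + 1)) := by
  have htb := half_le_tau hb
  have h4 : (j : ℝ) / 2 ^ (n + 1) ≤ ((j + 1 : ℕ) : ℝ) / 2 ^ (n + 1) := by
    gcongr; omega
  have h0 : 0 ≤ (j : ℝ) / 2 ^ (n + 1) := by positivity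
  have m1 : ((j : ℝ) / 2 ^ (n + 1) + tau b) / 2 ∈ Set.Icc (0 : ℝ) (1 / 2) := by
    constructor <;> linarith
  have m2 : (((j + 1 : ℕ) : ℝ) / 2 ^ (n + 1) + tau b) / 2 ∈ Set.Icc (0 : ℝ) (1 / 2) := by
    constructor <;> linarith
  refine (h.nlMean_grid_mid_le hb hj h1 h2 (by linarith [(h.mem_Icc m1).2])
    (by linarith [(h.mem_Icc m2).2])).trans ((h.nlMean_le_mid m1 m2).trans_eq ?_)
  rw [grid_mid]
  congr 1; ring

lemma mixedAt_of_tau_le_base {b : ℝ} (hb : 1 ≤ b) (htb : tau b ≤ 1 / 2 + 1 / 128) {s : ℝ}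
    (hs : s ∈ Set.Icc (0 : ℝ) (1 / 2)) (hsb : s + tau b ≤ 1) : MixedAt A b s := by
  have htb' := half_le_tau hb
  have high : ∀ s, 1 / 4 ≤ s → s ≤ 1 / 2 → s + tau b ≤ 1 → MixedAt A b s := by
    intro s hs hs' hsb
    have h1 := h.slope (x := (s + 1 / 2) / 2) (y := (s + tau b) / 2) (by linarith) (by linarith)
      (by linarith)
    have hm : s ∈ Set.Icc (0 : ℝ) (1 / 2) := ⟨by linarith, hs'⟩
    have h2 := h.nlMean_le_mid hm (t := 1 / 2) ⟨by norm_num, le_rfl⟩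
    rw [h.half] at h2
    have h3 := nlMean_le_add (h.mem_Icc hm).1 (h.mem_Icc hm).2 hb
    have hb2 : b ≤ 1.02 := by
      refine le_of_tau_le (by norm_num) (htb.trans ?_)
      norm_num [tau]
    have h4 : (b - 1) / 2 ≤ 1.02 * (tau b - 1 / 2) := by
      have : tau b - 1 / 2 = (b - 1) * (b + 1) / (2 * (1 + b ^ 2)) := by
        unfold tau; field_simp; ring
      rw [this, mul_div_assoc', div_le_div_iff₀ (by norm_num) (by positivity)]
      nlinarith [mul_nonneg (sub_nonneg.2 hb) (by nlinarith : 0 ≤ 1.02 * (b + 1) - (1 + b ^ 2))]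
    unfold MixedAt
    linarith
  refine h.mixedAt_of_step hb (fun n j hj hjb h1 h2 => ?_) hs hsb
  rcases le_total (1 / 4) (((2 * j + 1 : ℕ) : ℝ) / 2 ^ (n + 1 + 1)) with h3 | h3
  · refine high _ h3 ?_ hjb
    exact (grid_mem (n := n + 1) (k := 2 * j + 1) (by rw [pow_succ]; omega)).2
  · have h4 : ((j + 1 : ℕ) : ℝ) / 2 ^ (n + 1) ≤ 1 / 4 ∨ n = 0 := by
      rcases n with _ | n
      · exact Or.inr rfl
      · left
        rw [div_le_iff₀ (by positivity)] at h3 ⊢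
        have e : (1 / 4 : ℝ) * 2 ^ (n + 1 + 1 + 1) = ((2 * 2 ^ n : ℕ) : ℝ) := by
          push_cast; rw [pow_succ, pow_succ, pow_succ]; ring
        have e' : (1 / 4 : ℝ) * 2 ^ (n + 1 + 1) = ((2 ^ n : ℕ) : ℝ) := by
          push_cast; rw [pow_succ, pow_succ]; ring
        rw [e] at h3
        rw [e']
        have h3' : 2 * j + 1 ≤ 2 * 2 ^ n := by exact_mod_cast h3
        exact_mod_cast (by omega : j + 1 ≤ 2 ^ n)
    rcases h4 with h4 | rfl
    · have h5 : ((j + 1 : ℕ) : ℝ) / 2 ^ (n + 1) + tau b ≤ 1 := by linarith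
      exact h.mixedAt_mid hb hj h1 (h2 h5) h5
    · obtain rfl : j = 0 := by simpa using hj
      exact high _ (by norm_num) (by norm_num) hjb

lemma mixedAt_double {κ : ℝ} (hκ : ∀ b, 1 ≤ b → tau b ≤ 1 / 2 + κ →
      ∀ s ∈ Set.Icc (0 : ℝ) (1 / 2), s + tau b ≤ 1 → MixedAt A b s)
    {b : ℝ} (hb : 1 ≤ b) (htb : tau b ≤ 1 / 2 + 2 * κ) {s : ℝ}
    (hs : s ∈ Set.Icc (0 : ℝ) (1 / 2)) (hsb : s + tau b ≤ 1) : MixedAt A b s := by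
  have htb' := half_le_tau hb
  refine h.mixedAt_of_step hb (fun n j hj hjb h1 h2 => ?_) hs hsb
  rcases le_or_gt (((j + 1 : ℕ) : ℝ) / 2 ^ (n + 1) + tau b) 1 with h3 | h3
  · exact h.mixedAt_mid hb hj h1 (h2 h3) h3
  · have e := grid_mid n j
    have hy := grid_mem (n := n) (k := j + 1) hj
    have hx0 : 0 ≤ (j : ℝ) / 2 ^ (n + 1) := by positivity
    set x := (j : ℝ) / 2 ^ (n + 1) with hx
    set y := ((j + 1 : ℕ) : ℝ) / 2 ^ (n + 1) with hyd
    have hxy : x ≤ y := by rw [hx, hyd]; gcongr; omega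
    have ht1 := tau_lt_one b
    set p := (x + tau b) / 2 with hp
    set q := (y + tau b) / 2 with hq
    have hp' : p ∈ Set.Icc (0 : ℝ) (1 / 2) := by constructor <;> linarith
    have hq1 : q ≤ 3 / 4 := by linarith [hy.2]
    have hq0 : 1 / 2 ≤ q := by linarith
    have hτ := tau_sqrt (t := q) (by linarith) (by linarith)
    set b' := √(q / (1 - q)) with hb'
    have hb'0 : 0 ≤ b' := Real.sqrt_nonneg _
    have hb'1 : 1 ≤ b' := le_of_tau_le hb'0 (by rw [tau_one, hτ]; exact hq0)
    have hb'2 : b' ≤ 2 := le_of_tau_le zero_le_two (by rw [hτ]; norm_num [tau]; linarith)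
    have hM : nlMean (A y) b ≤ b' := by
      refine le_of_tau_le hb'0 ((tau_nlMean_le _ _).trans ?_)
      have := h.tau_le hy
      rw [hτ]; linarith
    refine (h.nlMean_grid_mid_le hb hj h1 hM (by linarith [(h.mem_Icc hp').2]) hb'2).trans ?_
    have h4 := hκ b' hb'1 (by rw [hτ]; linarith [hy.2]) p hp' (by rw [hτ]; linarith)
    unfold MixedAt at h4
    refine h4.trans_eq ?_
    rw [hτ, e]
    congr 1; rw [hp, hq]; ring

lemma mixedAt {b : ℝ} (hb : 1 ≤ b) {s : ℝ} (hs : s ∈ Set.Icc (0 : ℝ) (1 / 2))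
    (hsb : s + tau b ≤ 1) : nlMean (A s) b ≤ A ((s + tau b) / 2) := by
  have key : ∀ m : ℕ, ∀ b, 1 ≤ b → tau b ≤ 1 / 2 + 2 ^ m * (1 / 128) →
      ∀ s ∈ Set.Icc (0 : ℝ) (1 / 2), s + tau b ≤ 1 → MixedAt A b s := by
    intro m
    induction m with
    | zero =>
      intro b hb htb s hs hsb
      exact h.mixedAt_of_tau_le_base hb (by simpa using htb) hs hsb
    | succ m ih =>
      intro b hb htb s hs hsb
      refine h.mixedAt_double ih hb ?_ hs hsb
      rw [pow_succ] at htb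
      linarith
  exact key 6 b hb (by have := tau_lt_one b; norm_num; linarith) s hs hsb

end IsBridge

end BridgeMixed

section Subsolution

/-- The inverse bridge on `[0,1]`, extended by `0` to the left and by the Cantelli profile to the
right. -/
def bridgeInvExt (B : ℝ → ℝ) (y : ℝ) : ℝ := if y ≤ 0 then 0 else if y ≤ 1 then B y else tau y

namespace IsBridge

variable {A : ℝ → ℝ} (h : IsBridge A) {B : ℝ → ℝ}
  (hB : ∀ t ∈ Set.Icc (0 : ℝ) (1 / 2), B (A t) = t)
  (hB' : ∀ x ∈ Set.Icc (0 : ℝ) 1, B x ∈ Set.Icc (0 : ℝ) (1 / 2) ∧ A (B x) = x)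
include h hB hB'

omit hB' in
lemma bridgeInvExt_apply {t : ℝ} (ht : t ∈ Set.Icc (0 : ℝ) (1 / 2)) :
    bridgeInvExt B (A t) = t := by
  unfold bridgeInvExt
  have h1 := h.mem_Icc ht
  split_ifs with h2 h3
  · have h3 : A t = A 0 := by rw [h.zero]; exact le_antisymm h2 h1.1
    exact (h.mono.injOn ht ⟨le_rfl, by norm_num⟩ h3).symm
  · exact hB t ht
  · exact absurd h1.2 h3

omit h hB hB' in
lemma bridgeInvExt_of_nonpos {y : ℝ} (hy : y ≤ 0) : bridgeInvExt B y = 0 := if_pos hy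

omit hB' in
lemma bridgeInvExt_of_one_le {y : ℝ} (hy : 1 ≤ y) : bridgeInvExt B y = tau y := by
  rcases hy.eq_or_lt with rfl | hy
  · rw [tau_one]
    have := h.bridgeInvExt_apply hB (t := 1 / 2) ⟨by norm_num, le_rfl⟩
    rwa [h.half] at this
  · unfold bridgeInvExt
    rw [if_neg (by linarith), if_neg (by linarith)]

lemma bridgeInvExt_of_mem {y : ℝ} (hy : y ∈ Set.Icc (0 : ℝ) 1) : bridgeInvExt B y = B y := by
  have := h.bridgeInvExt_apply hB (hB' y hy).1
  rwa [(hB' y hy).2] at this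

omit h hB in
lemma bridgeInvExt_nonneg (y : ℝ) : 0 ≤ bridgeInvExt B y := by
  unfold bridgeInvExt
  split_ifs with h1 h2
  · exact le_rfl
  · exact (hB' y ⟨by linarith, h2⟩).1.1
  · unfold tau; positivity

omit h hB in
lemma bridgeInvExt_le_one (y : ℝ) : bridgeInvExt B y ≤ 1 := by
  unfold bridgeInvExt
  split_ifs with h1 h2
  · exact zero_le_one
  · linarith [(hB' y ⟨by linarith, h2⟩).1.2]
  · exact (tau_lt_one y).le

omit h hB in
lemma bridgeInvExt_le_half {y : ℝ} (hy : y ≤ 1) : bridgeInvExt B y ≤ 1 / 2 := by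
  unfold bridgeInvExt
  split_ifs with h1
  · norm_num
  · exact (hB' y ⟨by linarith, hy⟩).1.2

lemma tau_le_bridgeInvExt {y : ℝ} (hy : 0 ≤ y) : tau y ≤ bridgeInvExt B y := by
  rcases le_total y 1 with h1 | h1
  · have h2 := hB' y ⟨hy, h1⟩
    have h3 := h.tau_le h2.1
    rwa [h2.2, ← h.bridgeInvExt_of_mem hB hB' ⟨hy, h1⟩] at h3
  · rw [h.bridgeInvExt_of_one_le hB h1]

lemma bridgeInvExt_mono {x y : ℝ} (hxy : x ≤ y) : bridgeInvExt B x ≤ bridgeInvExt B y := by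
  rcases le_total x 0 with h1 | h1
  · rw [bridgeInvExt_of_nonpos h1]
    exact IsBridge.bridgeInvExt_nonneg hB' y
  rcases le_total 1 y with h2 | h2
  · rcases le_total 1 x with h3 | h3
    · rw [h.bridgeInvExt_of_one_le hB h3, h.bridgeInvExt_of_one_le hB h2]
      exact tau_le_tau h1 hxy
    · rw [h.bridgeInvExt_of_one_le hB h2]
      refine (IsBridge.bridgeInvExt_le_half hB' h3).trans ?_
      rw [← tau_one]
      exact tau_le_tau zero_le_one h2
  · have hx : x ∈ Set.Icc (0 : ℝ) 1 := ⟨h1, by linarith⟩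
    have hy : y ∈ Set.Icc (0 : ℝ) 1 := ⟨by linarith, h2⟩
    rw [h.bridgeInvExt_of_mem hB hB' hx, h.bridgeInvExt_of_mem hB hB' hy]
    by_contra! h3
    have h4 := h.mono (hB' y hy).1 (hB' x hx).1 h3
    rw [(hB' y hy).2, (hB' x hx).2] at h4
    linarith

lemma bridgeInvExt_nlMean_le_of_nonneg {u v : ℝ} (hu : 0 ≤ u) (huv : u ≤ v) :
    bridgeInvExt B (nlMean u v) ≤ (bridgeInvExt B u + bridgeInvExt B v) / 2 := by
  have hv : 0 ≤ v := hu.trans huv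
  rcases le_total 1 (u * v) with h1 | h1
  · rw [h.bridgeInvExt_of_one_le hB (one_le_nlMean (by linarith) h1)]
    have h2 := tau_nlMean_le u v
    have h3 := h.tau_le_bridgeInvExt hB hB' hu
    have h4 := h.tau_le_bridgeInvExt hB hB' hv
    linarith
  have hu1 : u ≤ 1 := by nlinarith
  have hu' := hB' u ⟨hu, hu1⟩
  rw [h.bridgeInvExt_of_mem hB hB' ⟨hu, hu1⟩]
  set s := B u
  have key : ∀ t, 0 ≤ t → s + t ≤ 1 → nlMean u v ≤ A ((s + t) / 2) →
      bridgeInvExt B (nlMean u v) ≤ (s + t) / 2 := by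
    intro t ht hst h2
    refine (h.bridgeInvExt_mono hB hB' h2).trans_eq (h.bridgeInvExt_apply hB ?_)
    constructor <;> linarith [hu'.1.1]
  rcases le_total v 1 with h2 | h2
  · have hv' := hB' v ⟨hv, h2⟩
    rw [h.bridgeInvExt_of_mem hB hB' ⟨hv, h2⟩]
    refine key _ hv'.1.1 (by linarith [hu'.1.2, hv'.1.2]) ?_
    have := h.nlMean_le_mid hu'.1 hv'.1
    rwa [hu'.2, hv'.2] at this
  · rw [h.bridgeInvExt_of_one_le hB h2]
    rcases le_total (s + tau v) 1 with h3 | h3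
    · refine key _ (by linarith [IsBridge.half_le_tau h2]) h3 ?_
      have := h.mixedAt h2 hu'.1 h3
      rwa [hu'.2] at this
    · exact (IsBridge.bridgeInvExt_le_half hB' (nlMean_le_one h1)).trans (by linarith)

lemma bridgeInvExt_nlMean_le (u v : ℝ) :
    bridgeInvExt B (nlMean u v) ≤ (bridgeInvExt B u + bridgeInvExt B v) / 2 := by
  wlog huv : u ≤ v generalizing u v
  · rw [nlMean_comm, add_comm]
    exact this v u (by linarith)
  rcases le_total 0 u with hu | hu
  · exact h.bridgeInvExt_nlMean_le_of_nonneg hB hB' hu huv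
  rcases le_total (u + v) 0 with h1 | h1
  · rw [bridgeInvExt_of_nonpos]
    · have := IsBridge.bridgeInvExt_nonneg hB' u
      have := IsBridge.bridgeInvExt_nonneg hB' v
      positivity
    · exact div_nonpos_of_nonpos_of_nonneg h1 (Real.sqrt_nonneg _)
  · refine (h.bridgeInvExt_mono hB hB' (nlMean_le_nlMean_zero hu h1)).trans
      ((h.bridgeInvExt_nlMean_le_of_nonneg hB hB' le_rfl (by linarith)).trans_eq ?_)
    rw [bridgeInvExt_of_nonpos hu, bridgeInvExt_of_nonpos le_rfl]

end IsBridge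

end Subsolution

section Cells

open Filter Topology
open scoped ENNReal

/-- The half-open dyadic interval `[k/2^n, (k+1)/2^n)`. -/
def dyadicCell (n k : ℕ) : Set ℝ := Set.Ico ((k : ℝ) / 2 ^ n) (((k : ℝ) + 1) / 2 ^ n)

/-- The index of the dyadic cell of generation `n` containing `x`. -/
def cellIndex (n : ℕ) (x : ℝ) : ℕ := ⌊x * 2 ^ n⌋₊

/-- The average of `f` over a dyadic cell. -/
def cellAvg (f : ℝ → ℝ) (n k : ℕ) : ℝ := 2 ^ n * ∫ x in dyadicCell n k, f x

lemma mem_dyadicCell_iff {n k : ℕ} {x : ℝ} (hx : 0 ≤ x) : x ∈ dyadicCell n k ↔ cellIndex n x = k := by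
  unfold dyadicCell cellIndex
  rw [Nat.floor_eq_iff (by positivity), Set.mem_Ico, div_le_iff₀ (by positivity),
    lt_div_iff₀ (by positivity)]

lemma dyadicCell_subset {n k : ℕ} (hk : k < 2 ^ n) : dyadicCell n k ⊆ Set.Ico 0 1 := by
  have : (k : ℝ) + 1 ≤ 2 ^ n := by exact_mod_cast hk
  apply Set.Ico_subset_Ico
  · positivity
  · rw [div_le_one (by positivity)]; exact this

lemma cellIndex_lt {n : ℕ} {x : ℝ} (hx : x ∈ Set.Ico (0 : ℝ) 1) : cellIndex n x < 2 ^ n := by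
  unfold cellIndex
  rw [Nat.floor_lt (by have := hx.1; positivity)]
  push_cast
  nlinarith [hx.2, pow_pos (two_pos : (0 : ℝ) < 2) n]

lemma cellIndex_succ_div_two (n : ℕ) (x : ℝ) : cellIndex (n + 1) x / 2 = cellIndex n x := by
  unfold cellIndex
  rw [← Nat.floor_div_natCast]
  congr 1
  push_cast; rw [pow_succ]; ring

lemma measurable_cellIndex (n : ℕ) : Measurable (cellIndex n) := by
  unfold cellIndex
  exact Nat.measurable_floor.comp (by fun_prop)

lemma measurableSet_dyadicCell (n k : ℕ) : MeasurableSet (dyadicCell n k) := measurableSet_Ico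

lemma volume_dyadicCell (n k : ℕ) : volume (dyadicCell n k) = ENNReal.ofReal (1 / 2 ^ n) := by
  unfold dyadicCell
  rw [Real.volume_Ico]
  congr 1; ring

lemma iUnion_dyadicCell (n : ℕ) : ⋃ k ∈ Finset.range (2 ^ n), dyadicCell n k = Set.Ico 0 1 := by
  ext x
  simp only [Set.mem_iUnion, Finset.mem_range, exists_prop]
  constructor
  · rintro ⟨k, hk, hx⟩
    exact dyadicCell_subset hk hx
  · intro hx
    exact ⟨cellIndex n x, cellIndex_lt hx, (mem_dyadicCell_iff hx.1).2 rfl⟩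

lemma pairwiseDisjoint_dyadicCell (n : ℕ) (s : Set ℕ) (hs : s ⊆ Set.Iio (2 ^ n)) :
    s.PairwiseDisjoint (dyadicCell n) := by
  intro i hi j hj hij
  refine Set.disjoint_left.2 fun x hx hx' => hij ?_
  have h0 := (dyadicCell_subset (hs hi) hx).1
  rw [mem_dyadicCell_iff h0] at hx hx'
  rw [← hx, ← hx']

lemma lintegral_cellIndex (n : ℕ) (w : ℕ → ℝ≥0∞) :
    ∫⁻ x in Set.Ico (0 : ℝ) 1, w (cellIndex n x)
      = ∑ k ∈ Finset.range (2 ^ n), w k * ENNReal.ofReal (1 / 2 ^ n) := by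
  rw [← iUnion_dyadicCell n, lintegral_biUnion_finset
    (pairwiseDisjoint_dyadicCell n _ (by intro k; simp)) fun k _ => measurableSet_dyadicCell n k]
  refine Finset.sum_congr rfl fun k hk => ?_
  rw [← volume_dyadicCell n k, ← setLIntegral_const]
  refine setLIntegral_congr_fun (measurableSet_dyadicCell n k) fun x hx => ?_
  have h0 := (dyadicCell_subset (Finset.mem_range.1 hk) hx).1
  simp only [(mem_dyadicCell_iff h0).1 hx]

lemma lintegral_cellIndex_ofReal (n : ℕ) {w : ℕ → ℝ} (hw : ∀ k < 2 ^ n, 0 ≤ w k) :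
    ∫⁻ x in Set.Ico (0 : ℝ) 1, ENNReal.ofReal (w (cellIndex n x))
      = ENNReal.ofReal ((∑ k ∈ Finset.range (2 ^ n), w k) / 2 ^ n) := by
  rw [lintegral_cellIndex n fun k => ENNReal.ofReal (w k), Finset.sum_div,
    ENNReal.ofReal_sum_of_nonneg fun k hk =>
      div_nonneg (hw k (Finset.mem_range.1 hk)) (by positivity)]
  refine Finset.sum_congr rfl fun k hk => ?_
  rw [← ENNReal.ofReal_mul (hw k (Finset.mem_range.1 hk)), mul_one_div]

lemma sum_range_two_mul {M : Type*} [AddCommMonoid M] (g : ℕ → M) (N : ℕ) :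
    ∑ k ∈ Finset.range (2 * N), g k = ∑ k ∈ Finset.range N, (g (2 * k) + g (2 * k + 1)) := by
  induction N with
  | zero => simp
  | succ N ih =>
    rw [mul_add, mul_one, Finset.sum_range_succ, Finset.sum_range_succ, ih,
      Finset.sum_range_succ _ N, add_assoc]

lemma dyadicCell_two_mul_union (n k : ℕ) :
    dyadicCell (n + 1) (2 * k) ∪ dyadicCell (n + 1) (2 * k + 1) = dyadicCell n k := by
  unfold dyadicCell
  have h1 : ((2 * k : ℕ) : ℝ) / 2 ^ (n + 1) = (k : ℝ) / 2 ^ n := by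
    push_cast; field_simp; ring
  have h2 : (((2 * k + 1 : ℕ) : ℝ) + 1) / 2 ^ (n + 1) = ((k : ℝ) + 1) / 2 ^ n := by
    push_cast; field_simp; ring
  have h3 : (((2 * k : ℕ) : ℝ) + 1) = ((2 * k + 1 : ℕ) : ℝ) := by push_cast; ring
  rw [h3, Set.Ico_union_Ico_eq_Ico, h1, h2]
  · gcongr; omega
  · gcongr; linarith

lemma disjoint_dyadicCell_two_mul (n k : ℕ) :
    Disjoint (dyadicCell (n + 1) (2 * k)) (dyadicCell (n + 1) (2 * k + 1)) := by
  unfold dyadicCell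
  rw [Set.Ico_disjoint_Ico]
  push_cast
  exact (min_le_left _ _).trans (le_max_right _ _)

lemma cellAvg_add {f : ℝ → ℝ} (hf : IntegrableOn f (Set.Ico 0 1))
    {n k : ℕ} (hk : k < 2 ^ n) :
    cellAvg f (n + 1) (2 * k) + cellAvg f (n + 1) (2 * k + 1) = 2 * cellAvg f n k := by
  unfold cellAvg
  have hi := hf.mono_set (dyadicCell_subset hk)
  rw [← dyadicCell_two_mul_union n k] at hi ⊢
  rw [setIntegral_union (disjoint_dyadicCell_two_mul n k) (measurableSet_dyadicCell _ _)
    hi.left_of_union hi.right_of_union, pow_succ]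
  ring

lemma haar_eq_indicator (n k : ℕ) (x : ℝ) : haar n k x
    = (dyadicCell (n + 1) (2 * k + 1)).indicator 1 x
      - (dyadicCell (n + 1) (2 * k)).indicator 1 x := by
  have h1 : ((2 * k : ℕ) : ℝ) / 2 ^ (n + 1) = (k : ℝ) / 2 ^ n := by
    push_cast; field_simp; ring
  have h2 : (((2 * k + 1 : ℕ) : ℝ) + 1) / 2 ^ (n + 1) = ((k : ℝ) + 1) / 2 ^ n := by
    push_cast; field_simp; ring
  have h3 : ((2 * k : ℕ) : ℝ) + 1 = 2 * (k : ℝ) + 1 := by push_cast; ring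
  have h4 : ((2 * k + 1 : ℕ) : ℝ) = 2 * (k : ℝ) + 1 := by push_cast; ring
  have hd : x ∈ dyadicCell (n + 1) (2 * k) → x ∉ dyadicCell (n + 1) (2 * k + 1) := fun hx =>
    Set.disjoint_left.1 (disjoint_dyadicCell_two_mul n k) hx
  unfold dyadicCell at *
  rw [h1, h2, h3, h4] at *
  unfold haar
  by_cases h5 : x ∈ Set.Ico ((k : ℝ) / 2 ^ n) ((2 * (k : ℝ) + 1) / 2 ^ (n + 1))
  · rw [if_pos h5, Set.indicator_of_notMem (hd h5), Set.indicator_of_mem h5]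
    simp
  · rw [if_neg h5, Set.indicator_of_notMem h5, Set.indicator_apply]
    simp

lemma haarCoeff_eq {f : ℝ → ℝ} (hf : IntegrableOn f (Set.Ico 0 1))
    {n k : ℕ} (hk : k < 2 ^ n) :
    haarCoeff f n k = (cellAvg f (n + 1) (2 * k + 1) - cellAvg f (n + 1) (2 * k)) / 2 := by
  have hs0 : dyadicCell (n + 1) (2 * k) ⊆ Set.Ico 0 1 :=
    dyadicCell_subset (by rw [pow_succ]; omega)
  have hs1 : dyadicCell (n + 1) (2 * k + 1) ⊆ Set.Ico 0 1 :=
    dyadicCell_subset (by rw [pow_succ]; omega)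
  have e : ∀ x, f x * haar n k x = (dyadicCell (n + 1) (2 * k + 1)).indicator f x
      - (dyadicCell (n + 1) (2 * k)).indicator f x := by
    intro x
    rw [haar_eq_indicator, mul_sub]
    classical
    simp only [Set.indicator_apply, Pi.one_apply, mul_ite, mul_one, mul_zero]
  unfold haarCoeff cellAvg
  rw [integral_Icc_eq_integral_Ico]
  simp_rw [e]
  rw [integral_sub (hf.indicator (measurableSet_dyadicCell _ _))
    (hf.indicator (measurableSet_dyadicCell _ _)),
    setIntegral_indicator (measurableSet_dyadicCell _ _),
    setIntegral_indicator (measurableSet_dyadicCell _ _),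
    Set.inter_eq_right.2 hs0, Set.inter_eq_right.2 hs1, pow_succ]
  ring

lemma cellAvg_left {f : ℝ → ℝ} (hf : IntegrableOn f (Set.Ico 0 1))
    {n k : ℕ} (hk : k < 2 ^ n) :
    cellAvg f (n + 1) (2 * k) = cellAvg f n k - haarCoeff f n k := by
  have := cellAvg_add hf hk
  have := haarCoeff_eq hf hk
  linarith

lemma cellAvg_right {f : ℝ → ℝ} (hf : IntegrableOn f (Set.Ico 0 1))
    {n k : ℕ} (hk : k < 2 ^ n) :
    cellAvg f (n + 1) (2 * k + 1) = cellAvg f n k + haarCoeff f n k := by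
  have := cellAvg_add hf hk
  have := haarCoeff_eq hf hk
  linarith

lemma sum_abs_cellAvg_le {f : ℝ → ℝ} (hf : IntegrableOn f (Set.Ico 0 1))
    (n : ℕ) :
    (∑ k ∈ Finset.range (2 ^ n), |cellAvg f n k|) / 2 ^ n ≤ ∫ x in Set.Ico (0 : ℝ) 1, |f x| := by
  rw [← iUnion_dyadicCell n, integral_biUnion_finset _ (fun k _ => measurableSet_dyadicCell n k)
    (pairwiseDisjoint_dyadicCell n _ (by intro k; simp)), Finset.sum_div]
  · refine Finset.sum_le_sum fun k hk => ?_
    unfold cellAvg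
    rw [abs_mul, abs_of_pos (by positivity), mul_div_cancel_left₀ _ (by positivity)]
    exact abs_integral_le_integral_abs
  · intro k hk
    exact (hf.mono_set (dyadicCell_subset (Finset.mem_range.1 hk))).abs

lemma ae_tendsto_cellAvg {f : ℝ → ℝ} (hf : IntegrableOn f (Set.Ico 0 1)) :
    ∀ᵐ x ∂(volume.restrict (Set.Ico (0 : ℝ) 1)),
    Tendsto (fun n => cellAvg f n (cellIndex n x)) atTop (𝓝 (f x)) := by
  have hF : LocallyIntegrable ((Set.Ico (0 : ℝ) 1).indicator f) volume :=
    ((integrable_indicator_iff measurableSet_Ico).2 hf).locallyIntegrable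
  rw [ae_restrict_iff' measurableSet_Ico]
  filter_upwards [IsUnifLocDoublingMeasure.ae_tendsto_average volume hF 1] with x hx hx01
  have hδ : Tendsto (fun n : ℕ => (1 / 2 : ℝ) ^ (n + 1)) atTop (𝓝[>] 0) := by
    refine tendsto_nhdsWithin_iff.2 ⟨?_, Eventually.of_forall fun n => ?_⟩
    · exact (tendsto_pow_atTop_nhds_zero_of_lt_one (by norm_num) (by norm_num)).comp
        (tendsto_add_atTop_nat 1)
    · exact Set.mem_Ioi.2 (by positivity)
  have hball : ∀ n : ℕ, Metric.closedBall (((cellIndex n x : ℝ) + 1 / 2) / 2 ^ n) ((1 / 2) ^ (n + 1))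
      = Set.Icc ((cellIndex n x : ℝ) / 2 ^ n) (((cellIndex n x : ℝ) + 1) / 2 ^ n) := by
    intro n
    rw [Real.closedBall_eq_Icc]
    congr 1
    · rw [one_div, inv_pow, pow_succ]; field_simp; ring
    · rw [one_div, inv_pow, pow_succ]; field_simp; ring
  have hmem : ∀ n, x ∈ dyadicCell n (cellIndex n x) := fun n => (mem_dyadicCell_iff hx01.1).2 rfl
  have := hx (fun n : ℕ => ((cellIndex n x : ℝ) + 1 / 2) / 2 ^ n) _ hδ
    (Eventually.of_forall fun n => by
      rw [one_mul, hball]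
      exact Set.Ico_subset_Icc_self (hmem n))
  rw [Set.indicator_of_mem hx01] at this
  refine this.congr fun n => ?_
  rw [hball, setAverage_eq, integral_Icc_eq_integral_Ico]
  unfold cellAvg
  have hsub := dyadicCell_subset (cellIndex_lt (n := n) hx01)
  have hv : volume.real (Set.Icc ((cellIndex n x : ℝ) / 2 ^ n) (((cellIndex n x : ℝ) + 1) / 2 ^ n))
      = (2 ^ n)⁻¹ := by
    rw [Real.volume_real_Icc_of_le (by gcongr; linarith)]
    field_simp; ring
  rw [hv, inv_inv, smul_eq_mul]
  congr 1
  refine setIntegral_congr_fun measurableSet_Ico fun y hy => ?_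
  exact Set.indicator_of_mem (hsub hy) f

end Cells

section SquareFunction

open Filter Topology
open scoped ENNReal

/-- The second difference of `√(1+y²)` at `c` with step `a`. -/
def hypDiff (c a : ℝ) : ℝ :=
  (√(1 + (c + a) ^ 2) + √(1 + (c - a) ^ 2)) / 2 - √(1 + c ^ 2)

lemma le_hypDiff (c a : ℝ) : a ^ 2 / (2 * (1 + c ^ 2 + a ^ 2) ^ 2) ≤ hypDiff c a := by
  unfold hypDiff
  have hP := Real.sq_sqrt (show 0 ≤ 1 + (c + a) ^ 2 by positivity)
  have hQ := Real.sq_sqrt (show 0 ≤ 1 + (c - a) ^ 2 by positivity)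
  have hF := Real.sq_sqrt (show 0 ≤ 1 + c ^ 2 by positivity)
  have hP0 : 1 ≤ √(1 + (c + a) ^ 2) := Real.one_le_sqrt.2 (by nlinarith [sq_nonneg (c + a)])
  have hQ0 : 1 ≤ √(1 + (c - a) ^ 2) := Real.one_le_sqrt.2 (by nlinarith [sq_nonneg (c - a)])
  have hF0 : 1 ≤ √(1 + c ^ 2) := Real.one_le_sqrt.2 (by nlinarith [sq_nonneg c])
  set P := √(1 + (c + a) ^ 2)
  set Q := √(1 + (c - a) ^ 2)
  set F := √(1 + c ^ 2)
  set L := 1 + c ^ 2 + a ^ 2 with hL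
  have hL1 : 1 ≤ L := by nlinarith [sq_nonneg c, sq_nonneg a]
  have hPQ : P * Q ≤ L := by nlinarith [sq_nonneg (P - Q)]
  have hPQ2 : (P * Q) ^ 2 = (L - 2 * a ^ 2) ^ 2 + 4 * a ^ 2 := by
    rw [mul_pow, hP, hQ, hL]; ring
  have hPQ3 : L - 2 * a ^ 2 ≤ P * Q := abs_le_of_sq_le_sq' (by nlinarith [sq_nonneg a])
    (by positivity) |>.2
  have h1 : 2 * a ^ 2 ≤ L * (P * Q - (L - 2 * a ^ 2)) := by
    nlinarith
  have h2 : (P + Q - 2 * F) * (P + Q + 2 * F) = 2 * (P * Q - (L - 2 * a ^ 2)) := by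
    nlinarith
  have hFL : F ≤ L := by nlinarith [sq_nonneg a]
  have hPQL : P + Q ≤ 2 * L := by
    nlinarith [sq_nonneg (P - Q), sq_nonneg (P + Q - 2)]
  have h3 : 0 ≤ P + Q - 2 * F := by
    by_contra h
    push Not at h
    nlinarith
  rw [div_le_iff₀ (by positivity)]
  have h4 : (P + Q - 2 * F) * (P + Q + 2 * F) ≤ (P + Q - 2 * F) * (4 * L) :=
    mul_le_mul_of_nonneg_left (by linarith) h3
  have h5 : L * ((P + Q - 2 * F) * (P + Q + 2 * F)) ≤ L * ((P + Q - 2 * F) * (4 * L)) :=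
    mul_le_mul_of_nonneg_left h4 (by linarith)
  nlinarith

lemma hypDiff_nonneg (c a : ℝ) : 0 ≤ hypDiff c a := (by positivity : (0 : ℝ) ≤ _).trans (le_hypDiff c a)

lemma sum_hypDiff {f : ℝ → ℝ} (hf : IntegrableOn f (Set.Ico 0 1)) (n : ℕ) :
    (∑ k ∈ Finset.range (2 ^ n), hypDiff (cellAvg f n k) (haarCoeff f n k)) / 2 ^ n
      = (∑ k ∈ Finset.range (2 ^ (n + 1)), √(1 + cellAvg f (n + 1) k ^ 2)) / 2 ^ (n + 1)
        - (∑ k ∈ Finset.range (2 ^ n), √(1 + cellAvg f n k ^ 2)) / 2 ^ n := by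
  have h : ∑ k ∈ Finset.range (2 ^ (n + 1)), √(1 + cellAvg f (n + 1) k ^ 2)
      = 2 * (∑ k ∈ Finset.range (2 ^ n), (hypDiff (cellAvg f n k) (haarCoeff f n k)
        + √(1 + cellAvg f n k ^ 2))) := by
    rw [pow_succ, mul_comm, sum_range_two_mul, Finset.mul_sum]
    refine Finset.sum_congr rfl fun k hk => ?_
    rw [cellAvg_left hf (Finset.mem_range.1 hk), cellAvg_right hf (Finset.mem_range.1 hk), hypDiff]
    ring
  rw [h, Finset.sum_add_distrib, pow_succ]
  field_simp
  ring

lemma sum_sqrt_cellAvg_le {f : ℝ → ℝ} (hf : IntegrableOn f (Set.Ico 0 1)) (n : ℕ) :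
    (∑ k ∈ Finset.range (2 ^ n), √(1 + cellAvg f n k ^ 2)) / 2 ^ n
      ≤ 1 + ∫ x in Set.Ico (0 : ℝ) 1, |f x| := by
  have h := sum_abs_cellAvg_le hf n
  have h1 : ∑ k ∈ Finset.range (2 ^ n), √(1 + cellAvg f n k ^ 2)
      ≤ ∑ k ∈ Finset.range (2 ^ n), (1 + |cellAvg f n k|) := by
    refine Finset.sum_le_sum fun k _ => ?_
    rw [Real.sqrt_le_left (by positivity)]
    nlinarith [abs_nonneg (cellAvg f n k), sq_abs (cellAvg f n k)]
  rw [Finset.sum_add_distrib] at h1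
  calc _ ≤ (_ + ∑ k ∈ Finset.range (2 ^ n), |cellAvg f n k|) / 2 ^ n :=
        div_le_div_of_nonneg_right h1 (by positivity)
    _ = 1 + (∑ k ∈ Finset.range (2 ^ n), |cellAvg f n k|) / 2 ^ n := by
        simp [add_div]
    _ ≤ _ := by linarith

lemma ae_summable_hypDiff {f : ℝ → ℝ} (hf : IntegrableOn f (Set.Ico 0 1)) :
    ∀ᵐ x ∂(volume.restrict (Set.Ico (0 : ℝ) 1)),
      Summable fun n => hypDiff (cellAvg f n (cellIndex n x)) (haarCoeff f n (cellIndex n x)) := by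
  set D : ℕ → ℕ → ℝ := fun n k => hypDiff (cellAvg f n k) (haarCoeff f n k) with hD
  have hD0 : ∀ n k, 0 ≤ D n k := fun n k => hypDiff_nonneg _ _
  have hm : ∀ n, Measurable fun x => ENNReal.ofReal (D n (cellIndex n x)) := fun n =>
    (measurable_from_nat (f := fun k => ENNReal.ofReal (D n k))).comp (measurable_cellIndex n)
  have hlt : ∫⁻ x in Set.Ico (0 : ℝ) 1, ∑' n, ENNReal.ofReal (D n (cellIndex n x)) ≠ ∞ := by
    rw [lintegral_tsum fun n => (hm n).aemeasurable]
    refine ne_top_of_le_ne_top (ENNReal.ofReal_ne_top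
      (r := 1 + ∫ x in Set.Ico (0 : ℝ) 1, |f x|)) ?_
    refine ENNReal.tsum_le_of_sum_range_le fun N => ?_
    have : ∀ n, ∫⁻ x in Set.Ico (0 : ℝ) 1, ENNReal.ofReal (D n (cellIndex n x))
        = ENNReal.ofReal ((∑ k ∈ Finset.range (2 ^ n), D n k) / 2 ^ n) := fun n =>
      lintegral_cellIndex_ofReal n fun k _ => hD0 n k
    simp_rw [this]
    rw [← ENNReal.ofReal_sum_of_nonneg fun n _ =>
      div_nonneg (Finset.sum_nonneg fun k _ => hD0 n k) (by positivity)]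
    refine ENNReal.ofReal_le_ofReal ?_
    rw [Finset.sum_congr rfl fun n _ => sum_hypDiff hf n, Finset.sum_range_sub
      (fun n => (∑ k ∈ Finset.range (2 ^ n), √(1 + cellAvg f n k ^ 2)) / 2 ^ n)]
    refine (sub_le_self _ ?_).trans (sum_sqrt_cellAvg_le hf N)
    positivity
  filter_upwards [ae_lt_top (Measurable.tsum hm) hlt] with x hx
  have := ENNReal.summable_toReal hx.ne
  refine this.congr fun n => ?_
  rw [ENNReal.toReal_ofReal (hD0 _ _)]

lemma cellAvg_cellIndex_succ {f : ℝ → ℝ} (hf : IntegrableOn f (Set.Ico 0 1)) {x : ℝ}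
    (hx : x ∈ Set.Ico (0 : ℝ) 1) (n : ℕ) :
    (haarCoeff f n (cellIndex n x)) ^ 2
      = (cellAvg f (n + 1) (cellIndex (n + 1) x) - cellAvg f n (cellIndex n x)) ^ 2 := by
  have h := cellIndex_succ_div_two n x
  have hk := cellIndex_lt (n := n) hx
  obtain h' | h' : cellIndex (n + 1) x = 2 * cellIndex n x
      ∨ cellIndex (n + 1) x = 2 * cellIndex n x + 1 := by omega
  · rw [h', cellAvg_left hf hk]; ring
  · rw [h', cellAvg_right hf hk]; ring

lemma ae_summable_haarCoeff {f : ℝ → ℝ} (hf : IntegrableOn f (Set.Ico 0 1)) :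
    ∀ᵐ x ∂(volume.restrict (Set.Ico (0 : ℝ) 1)),
      Summable fun n => haarCoeff f n (cellIndex n x) ^ 2 := by
  filter_upwards [ae_summable_hypDiff hf, ae_tendsto_cellAvg hf,
    ae_restrict_mem measurableSet_Ico] with x hx hc hx01
  obtain ⟨R, hR⟩ := (hc.norm).bddAbove_range
  have hR' : ∀ n, |cellAvg f n (cellIndex n x)| ≤ R := fun n => hR ⟨n, rfl⟩
  refine Summable.of_nonneg_of_le (fun n => sq_nonneg _) (fun n => ?_)
    (hx.mul_left (2 * (1 + 5 * R ^ 2) ^ 2))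
  have hle := le_hypDiff (cellAvg f n (cellIndex n x)) (haarCoeff f n (cellIndex n x))
  rw [div_le_iff₀ (by positivity)] at hle
  have h0 := hypDiff_nonneg (cellAvg f n (cellIndex n x)) (haarCoeff f n (cellIndex n x))
  have hc2 := sq_le_sq' (abs_le.1 (hR' n)).1 (abs_le.1 (hR' n)).2
  have hb2 := sq_le_sq' (abs_le.1 (hR' (n + 1))).1 (abs_le.1 (hR' (n + 1))).2
  have ha2 : haarCoeff f n (cellIndex n x) ^ 2 ≤ 4 * R ^ 2 := by
    rw [cellAvg_cellIndex_succ hf hx01]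
    nlinarith [sq_nonneg (cellAvg f (n + 1) (cellIndex (n + 1) x) + cellAvg f n (cellIndex n x))]
  refine hle.trans ?_
  rw [mul_comm]
  refine mul_le_mul_of_nonneg_right ?_ h0
  have : 1 + cellAvg f n (cellIndex n x) ^ 2 + haarCoeff f n (cellIndex n x) ^ 2
    ≤ 1 + 5 * R ^ 2 := by linarith
  gcongr

lemma ae_not_dyadic : ∀ᵐ x : ℝ, ∀ n k : ℕ, x ≠ (k : ℝ) / 2 ^ n := by
  rw [ae_all_iff]; intro n
  rw [ae_all_iff]; intro k
  exact Measure.ae_ne volume _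

lemma sqFn_term_eq (f : ℝ → ℝ) {x : ℝ} (hx : 0 ≤ x) (hd : ∀ n k : ℕ, x ≠ (k : ℝ) / 2 ^ n)
    (p : ℕ × ℕ) : haarCoeff f p.1 p.2 ^ 2 * (dyadicI p.1 p.2).indicator 1 x
      = if p.2 = cellIndex p.1 x then haarCoeff f p.1 p.2 ^ 2 else 0 := by
  have : x ∈ dyadicI p.1 p.2 ↔ p.2 = cellIndex p.1 x := by
    rw [eq_comm, ← mem_dyadicCell_iff hx]
    unfold dyadicI dyadicCell
    rw [Set.mem_Icc, Set.mem_Ico]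
    have := hd p.1 (p.2 + 1)
    push_cast at this
    exact and_congr_right fun _ => ⟨fun h => lt_of_le_of_ne h this, le_of_lt⟩
  classical
  simp [Set.indicator_apply, this]

lemma sqFn_eq (f : ℝ → ℝ) {x : ℝ} (hx : 0 ≤ x) (hd : ∀ n k : ℕ, x ≠ (k : ℝ) / 2 ^ n) :
    sqFn f x = √(∑' n, haarCoeff f n (cellIndex n x) ^ 2) := by
  unfold sqFn
  simp_rw [sqFn_term_eq f hx hd]
  have hinj : Function.Injective fun n : ℕ => (n, cellIndex n x) := fun a b h => by
    simpa using congrArg Prod.fst h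
  rw [← hinj.tsum_eq]
  · simp
  · intro p hp
    rw [Function.mem_support] at hp
    refine ⟨p.1, ?_⟩
    by_contra h
    refine hp (if_neg fun h' => h ?_)
    exact Prod.ext rfl h'.symm

/-- The sum of the squared Haar coefficients over the dyadic strict ancestors of a cell. -/
def sqSum (f : ℝ → ℝ) : ℕ → ℕ → ℝ
  | 0, _ => 0
  | n + 1, k => sqSum f n (k / 2) + haarCoeff f n (k / 2) ^ 2

lemma sqSum_cellIndex (f : ℝ → ℝ) (x : ℝ) (n : ℕ) :
    sqSum f n (cellIndex n x) = ∑ m ∈ Finset.range n, haarCoeff f m (cellIndex m x) ^ 2 := by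
  induction n with
  | zero => simp [sqSum]
  | succ n ih => rw [sqSum, Finset.sum_range_succ, cellIndex_succ_div_two, ih]

lemma Admissible.integrableOn_Ico {f : ℝ → ℝ} (h : Admissible f) :
    IntegrableOn f (Set.Ico 0 1) := h.1.mono_set Set.Ico_subset_Icc_self

lemma Admissible.cellAvg_zero {f : ℝ → ℝ} (h : Admissible f) : cellAvg f 0 0 = 0 := by
  have := h.2.1
  rw [integral_Icc_eq_integral_Ico] at this
  simpa [cellAvg, dyadicCell] using this

lemma Admissible.sqSum_le_one {f : ℝ → ℝ} (h : Admissible f) {n k : ℕ} (hk : k < 2 ^ n) :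
    sqSum f n k ≤ 1 := by
  have h3 : ∀ᵐ x ∂(volume.restrict (Set.Ico (0 : ℝ) 1)), sqFn f x ≤ 1 :=
    ae_restrict_of_ae_restrict_of_subset Set.Ico_subset_Icc_self h.2.2
  have hq : ∀ᵐ x ∂(volume.restrict (Set.Ico (0 : ℝ) 1)), sqSum f n (cellIndex n x) ≤ 1 := by
    filter_upwards [h3, ae_summable_haarCoeff h.integrableOn_Ico,
      ae_restrict_of_ae ae_not_dyadic, ae_restrict_mem measurableSet_Ico] with x h1 h2 h3 h4
    rw [sqFn_eq f h4.1 h3, Real.sqrt_le_one] at h1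
    rw [sqSum_cellIndex]
    exact (h2.sum_le_tsum _ fun _ _ => sq_nonneg _).trans h1
  by_contra hcon
  have hsub : dyadicCell n k ⊆ Set.Ico (0 : ℝ) 1 := dyadicCell_subset hk
  have hq' := ae_restrict_of_ae_restrict_of_subset hsub hq
  rw [ae_restrict_iff' (measurableSet_dyadicCell n k)] at hq'
  have : volume (dyadicCell n k) = 0 := by
    refine measure_mono_null (fun x hx => ?_) (ae_iff.1 hq')
    intro hcon'
    have := hcon' hx
    rw [(mem_dyadicCell_iff (hsub hx).1).1 hx] at this
    exact hcon this
  rw [volume_dyadicCell, ENNReal.ofReal_eq_zero] at this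
  exact absurd this (not_le.2 (by positivity))

lemma admissible_of_sqSum_le_one {f : ℝ → ℝ} (hf : IntegrableOn f (Set.Ico 0 1))
    (h0 : cellAvg f 0 0 = 0) (hq : ∀ n k, k < 2 ^ n → sqSum f n k ≤ 1) : Admissible f := by
  refine ⟨(integrableOn_Icc_iff_integrableOn_Ico (by simp)).2 hf, ?_, ?_⟩
  · rw [integral_Icc_eq_integral_Ico]
    simpa [cellAvg, dyadicCell] using h0
  · rw [restrict_Ico_eq_restrict_Icc.symm]
    filter_upwards [ae_restrict_of_ae ae_not_dyadic, ae_restrict_mem measurableSet_Ico]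
      with x h3 h4
    rw [sqFn_eq f h4.1 h3, Real.sqrt_le_one]
    refine Real.tsum_le_of_sum_range_le (fun _ => sq_nonneg _) fun n => ?_
    rw [← sqSum_cellIndex]
    exact hq n _ (cellIndex_lt h4)

end SquareFunction

section UpperBound

open Filter Topology
open scoped ENNReal

lemma sqSum_two_mul (f : ℝ → ℝ) (n k : ℕ) :
    sqSum f (n + 1) (2 * k) = sqSum f n k + haarCoeff f n k ^ 2 := by
  rw [sqSum, Nat.mul_div_cancel_left _ two_pos]

lemma sqSum_two_mul_add_one (f : ℝ → ℝ) (n k : ℕ) :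
    sqSum f (n + 1) (2 * k + 1) = sqSum f n k + haarCoeff f n k ^ 2 := by
  rw [sqSum, show (2 * k + 1) / 2 = k by omega]

/-- The Bellman potential of `f` at level `x` on the dyadic cells, with the square function
budget `l`. -/
def potential (B f : ℝ → ℝ) (x l : ℝ) (n k : ℕ) : ℝ :=
  1 - bridgeInvExt B ((x - cellAvg f n k) / √(l - sqSum f n k))

variable {A B : ℝ → ℝ} (h : IsBridge A)
  (hB : ∀ t ∈ Set.Icc (0 : ℝ) (1 / 2), B (A t) = t)
  (hB' : ∀ x ∈ Set.Icc (0 : ℝ) 1, B x ∈ Set.Icc (0 : ℝ) (1 / 2) ∧ A (B x) = x)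
include h hB hB'

lemma Admissible.potential_add_le {f : ℝ → ℝ} (hf : Admissible f) {x l : ℝ} (hl : 1 < l)
    {n k : ℕ} (hk : k < 2 ^ n) :
    potential B f x l (n + 1) (2 * k) + potential B f x l (n + 1) (2 * k + 1)
      ≤ 2 * potential B f x l n k := by
  have hq := hf.sqSum_le_one (n := n + 1) (k := 2 * k) (by rw [pow_succ]; omega)
  rw [sqSum_two_mul] at hq
  have hs := nlMean_shift (z := x - cellAvg f n k) (a := haarCoeff f n k)
    (l := l - sqSum f n k) (by linarith)
  have := h.bridgeInvExt_nlMean_le hB hB'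
    ((x - cellAvg f n k - haarCoeff f n k) / √(l - sqSum f n k - haarCoeff f n k ^ 2))
    ((x - cellAvg f n k + haarCoeff f n k) / √(l - sqSum f n k - haarCoeff f n k ^ 2))
  rw [hs] at this
  unfold potential
  rw [cellAvg_left hf.integrableOn_Ico hk, cellAvg_right hf.integrableOn_Ico hk, sqSum_two_mul,
    sqSum_two_mul_add_one, ← sub_sub l, ← sub_sub x, sub_sub_eq_add_sub x,
    add_sub_right_comm x]
  linarith

lemma Admissible.sum_potential_le {f : ℝ → ℝ} (hf : Admissible f) {x l : ℝ} (hl : 1 < l)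
    (n : ℕ) :
    (∑ k ∈ Finset.range (2 ^ n), potential B f x l n k) / 2 ^ n ≤ potential B f x l 0 0 := by
  induction n with
  | zero => simp
  | succ n ih =>
    refine le_trans ?_ ih
    rw [div_le_div_iff₀ (by positivity) (by positivity), pow_succ, mul_comm (2 ^ n) 2,
      sum_range_two_mul]
    have : ∑ k ∈ Finset.range (2 ^ n),
        (potential B f x l (n + 1) (2 * k) + potential B f x l (n + 1) (2 * k + 1))
        ≤ 2 * ∑ k ∈ Finset.range (2 ^ n), potential B f x l n k := by
      rw [Finset.mul_sum]
      exact Finset.sum_le_sum fun k hk =>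
        hf.potential_add_le h hB hB' hl (Finset.mem_range.1 hk)
    have h2 : (0 : ℝ) < 2 ^ n := by positivity
    rw [pow_succ]
    nlinarith

lemma Admissible.volume_le {f : ℝ → ℝ} (hf : Admissible f) {x ε : ℝ} (hε : 0 < ε) :
    volume {y ∈ Set.Icc (0 : ℝ) 1 | x ≤ f y}
      ≤ ENNReal.ofReal (1 - bridgeInvExt B ((x - ε) / √(1 + ε))) := by
  have hw0 : ∀ n k, 0 ≤ potential B f (x - ε) (1 + ε) n k := fun n k =>
    sub_nonneg.2 (IsBridge.bridgeInvExt_le_one hB' _)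
  have h00 : potential B f (x - ε) (1 + ε) 0 0 = 1 - bridgeInvExt B ((x - ε) / √(1 + ε)) := by
    simp [potential, hf.cellAvg_zero, sqSum]
  set w := potential B f (x - ε) (1 + ε) with hw
  have hm : ∀ n, Measurable fun y => ENNReal.ofReal (w n (cellIndex n y)) := fun n =>
    (measurable_from_nat (f := fun k => ENNReal.ofReal (w n k))).comp (measurable_cellIndex n)
  have hI : ∀ n, ∫⁻ y in Set.Ico (0 : ℝ) 1, ENNReal.ofReal (w n (cellIndex n y))
      ≤ ENNReal.ofReal (w 0 0) := fun n => by
    rw [lintegral_cellIndex_ofReal n fun k _ => hw0 n k]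
    exact ENNReal.ofReal_le_ofReal (hf.sum_potential_le h hB hB' (by linarith) n)
  have hone : ∀ᵐ y ∂(volume.restrict (Set.Ico (0 : ℝ) 1)), x ≤ f y →
      1 ≤ liminf (fun n => ENNReal.ofReal (w n (cellIndex n y))) atTop := by
    filter_upwards [ae_tendsto_cellAvg hf.integrableOn_Ico] with y hy hxy
    refine le_liminf_of_le (by isBoundedDefault) ?_
    filter_upwards [hy.eventually_const_lt (show x - ε < f y by linarith)] with n hn
    have : w n (cellIndex n y) = 1 := by
      rw [hw, potential, IsBridge.bridgeInvExt_of_nonpos, sub_zero]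
      exact div_nonpos_of_nonpos_of_nonneg (by linarith) (Real.sqrt_nonneg _)
    rw [this, ENNReal.ofReal_one]
  calc volume {y ∈ Set.Icc (0 : ℝ) 1 | x ≤ f y}
      ≤ volume.restrict (Set.Icc (0 : ℝ) 1) {y | x ≤ f y} := by
        rw [Set.ofPred_and, Set.inter_comm]
        exact Measure.le_restrict_apply _ _
    _ = volume.restrict (Set.Ico (0 : ℝ) 1) {y | x ≤ f y} := by
        rw [restrict_Ico_eq_restrict_Icc]
    _ ≤ volume.restrict (Set.Ico (0 : ℝ) 1)
          {y | 1 ≤ liminf (fun n => ENNReal.ofReal (w n (cellIndex n y))) atTop} :=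
        measure_mono_ae hone
    _ ≤ ∫⁻ y in Set.Ico (0 : ℝ) 1,
          liminf (fun n => ENNReal.ofReal (w n (cellIndex n y))) atTop := by
        simpa using mul_meas_ge_le_lintegral (μ := volume.restrict (Set.Ico (0 : ℝ) 1))
          (Measurable.liminf hm) 1
    _ ≤ liminf (fun n => ∫⁻ y in Set.Ico (0 : ℝ) 1, ENNReal.ofReal (w n (cellIndex n y))) atTop :=
        lintegral_liminf_le hm
    _ ≤ ENNReal.ofReal (w 0 0) := by
        refine liminf_le_of_le (by isBoundedDefault) fun b hb => ?_
        obtain ⟨n, hn⟩ := hb.exists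
        exact hn.trans (hI n)
    _ = _ := by rw [h00]

lemma Admissible.volume_toReal_le {f : ℝ → ℝ} (hf : Admissible f) {x : ℝ}
    (hx : x ∈ Set.Icc (0 : ℝ) 1) :
    (volume {y ∈ Set.Icc (0 : ℝ) 1 | x ≤ f y}).toReal ≤ 1 - B x := by
  obtain ⟨hBx, hABx⟩ := hB' x hx
  refine le_of_forall_pos_le_add fun δ hδ => ?_
  have key : ∀ t ∈ Set.Icc (0 : ℝ) (1 / 2), t < B x →
      (volume {y ∈ Set.Icc (0 : ℝ) 1 | x ≤ f y}).toReal ≤ 1 - t := by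
    intro t ht htx
    have hlt : A t < x := hABx ▸ h.mono ht hBx htx
    have hcont : Tendsto (fun ε : ℝ => (x - ε) / √(1 + ε)) (𝓝[>] 0) (𝓝 ((x - 0) / √(1 + 0))) := by
      refine Tendsto.mono_left (ContinuousAt.tendsto ?_) nhdsWithin_le_nhds
      refine ContinuousAt.div (by fun_prop) (by fun_prop) (by simp)
    have hlt' : A t < (x - 0) / √(1 + 0) := by simpa using hlt
    obtain ⟨ε, hε, hε0⟩ := ((hcont.eventually_const_lt hlt').and self_mem_nhdsWithin).exists
    have hv := hf.volume_le h hB hB' (x := x) (Set.mem_Ioi.1 hε0)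
    refine (ENNReal.toReal_mono ENNReal.ofReal_ne_top hv).trans ?_
    rw [ENNReal.toReal_ofReal (sub_nonneg.2 (IsBridge.bridgeInvExt_le_one hB' _))]
    have := h.bridgeInvExt_mono hB hB' hε.le
    rw [h.bridgeInvExt_apply hB ht] at this
    linarith
  obtain h0 | h0 := hBx.1.eq_or_lt
  · rw [← h0]
    have : (volume {y ∈ Set.Icc (0 : ℝ) 1 | x ≤ f y}).toReal ≤ (volume (Set.Icc (0 : ℝ) 1)).toReal :=
      ENNReal.toReal_mono (by simp) (measure_mono fun y hy => hy.1)
    simp only [Real.volume_Icc, sub_zero, ENNReal.ofReal_one, ENNReal.toReal_one] at this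
    linarith
  · have := key (max 0 (B x - δ)) ⟨le_max_left _ _, max_le (by norm_num) (by linarith [hBx.2])⟩
      (max_lt h0 (by linarith))
    linarith [le_max_right 0 (B x - δ)]

end UpperBound

section LowerBound

open Filter Topology
open scoped ENNReal

/-- The function equal to `-τ + σ f₀` on the left half of `[0,1)` and to `τ + σ f₁` on the right
half, with `f₀` and `f₁` rescaled to the halves. -/
def glue (τ σ : ℝ) (f₀ f₁ : ℝ → ℝ) (x : ℝ) : ℝ :=
  if x < 1 / 2 then -τ + σ * f₀ (2 * x) else τ + σ * f₁ (2 * x - 1)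

lemma cellAvg_eq_intervalIntegral (f : ℝ → ℝ) (n k : ℕ) :
    cellAvg f n k = 2 ^ n * ∫ x in ((k : ℝ) / 2 ^ n)..(((k : ℝ) + 1) / 2 ^ n), f x := by
  rw [cellAvg, dyadicCell, integral_Ico_eq_integral_Ioc,
    intervalIntegral.integral_of_le (by gcongr; linarith)]

lemma integrableOn_Ico_of_bounded {f : ℝ → ℝ} (hm : Measurable f) {C : ℝ} (hC : ∀ x, |f x| ≤ C)
    (a b : ℝ) : IntegrableOn f (Set.Ico a b) :=
  Measure.integrableOn_of_bounded (by simp) hm.aestronglyMeasurable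
    (Eventually.of_forall hC)

lemma measurable_glue {τ σ : ℝ} {f₀ f₁ : ℝ → ℝ} (h₀ : Measurable f₀) (h₁ : Measurable f₁) :
    Measurable (glue τ σ f₀ f₁) :=
  Measurable.ite measurableSet_Iio
    (((h₀.comp (measurable_const_mul 2)).const_mul σ).const_add _)
    (((h₁.comp ((measurable_const_mul 2).sub_const 1)).const_mul σ).const_add _)

lemma abs_glue_le {τ σ C₀ C₁ : ℝ} {f₀ f₁ : ℝ → ℝ} (h₀ : ∀ x, |f₀ x| ≤ C₀) (h₁ : ∀ x, |f₁ x| ≤ C₁)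
    (x : ℝ) : |glue τ σ f₀ f₁ x| ≤ |τ| + |σ| * max C₀ C₁ := by
  unfold glue
  split_ifs
  · refine (abs_add_le _ _).trans ?_
    rw [abs_neg, abs_mul]
    gcongr
    exact (h₀ _).trans (le_max_left _ _)
  · refine (abs_add_le _ _).trans ?_
    rw [abs_mul]
    gcongr
    exact (h₁ _).trans (le_max_right _ _)

lemma integral_affine_rescale {f : ℝ → ℝ} (hm : Measurable f) {C : ℝ} (hC : ∀ x, |f x| ≤ C)
    (τ σ d : ℝ) {a b : ℝ} (hab : a ≤ b) :
    ∫ x in a..b, (τ + σ * f (2 * x - d))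
      = τ * (b - a) + σ / 2 * ∫ x in (2 * a - d)..(2 * b - d), f x := by
  have hi : IntervalIntegrable (fun x => σ * f (2 * x - d)) volume a b := by
    rw [intervalIntegrable_iff_integrableOn_Ico_of_le hab]
    refine integrableOn_Ico_of_bounded (C := |σ| * C) ?_ (fun x => ?_) a b
    · exact (hm.comp ((measurable_const_mul 2).sub_const d)).const_mul σ
    · rw [abs_mul]
      exact mul_le_mul_of_nonneg_left (hC _) (abs_nonneg _)
  rw [intervalIntegral.integral_add (by simp) hi, intervalIntegral.integral_const,
    intervalIntegral.integral_const_mul,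
    intervalIntegral.integral_comp_mul_sub (fun x => f x) two_ne_zero, smul_eq_mul, smul_eq_mul]
  ring

lemma cellAvg_glue_left {τ σ C : ℝ} {f₀ : ℝ → ℝ} (hm : Measurable f₀) (hC : ∀ x, |f₀ x| ≤ C)
    (f₁ : ℝ → ℝ) {n k : ℕ} (hk : k < 2 ^ n) :
    cellAvg (glue τ σ f₀ f₁) (n + 1) k = -τ + σ * cellAvg f₀ n k := by
  have h1 : ((k : ℝ) + 1) / 2 ^ (n + 1) ≤ 1 / 2 := by
    have : (k : ℝ) + 1 ≤ 2 ^ n := by exact_mod_cast hk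
    rw [div_le_div_iff₀ (by positivity) (by positivity), pow_succ]
    linarith
  have h2 : ∫ x in dyadicCell (n + 1) k, glue τ σ f₀ f₁ x
      = ∫ x in dyadicCell (n + 1) k, (-τ + σ * f₀ (2 * x - 0)) := by
    refine setIntegral_congr_fun (measurableSet_dyadicCell _ _) fun x hx => ?_
    simp only [glue, if_pos (hx.2.trans_le h1), sub_zero]
  have h3 := cellAvg_eq_intervalIntegral (fun x => -τ + σ * f₀ (2 * x - 0)) (n + 1) k
  rw [cellAvg] at h3
  rw [cellAvg, h2, h3, integral_affine_rescale hm hC _ _ _ (by gcongr; linarith),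
    cellAvg_eq_intervalIntegral]
  have e1 : 2 * ((k : ℝ) / 2 ^ (n + 1)) - 0 = (k : ℝ) / 2 ^ n := by rw [pow_succ]; field_simp; ring
  have e2 : 2 * (((k : ℝ) + 1) / 2 ^ (n + 1)) - 0 = ((k : ℝ) + 1) / 2 ^ n := by
    rw [pow_succ]; field_simp; ring
  rw [e1, e2, pow_succ]
  field_simp
  ring

lemma cellAvg_glue_right {τ σ C : ℝ} {f₁ : ℝ → ℝ} (hm : Measurable f₁) (hC : ∀ x, |f₁ x| ≤ C)
    (f₀ : ℝ → ℝ) (n k : ℕ) :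
    cellAvg (glue τ σ f₀ f₁) (n + 1) (2 ^ n + k) = τ + σ * cellAvg f₁ n k := by
  have h1 : 1 / 2 ≤ ((2 ^ n + k : ℕ) : ℝ) / 2 ^ (n + 1) := by
    rw [div_le_div_iff₀ (by positivity) (by positivity), pow_succ]
    push_cast
    have : (0 : ℝ) ≤ k := by positivity
    linarith
  have h2 : ∫ x in dyadicCell (n + 1) (2 ^ n + k), glue τ σ f₀ f₁ x
      = ∫ x in dyadicCell (n + 1) (2 ^ n + k), (τ + σ * f₁ (2 * x - 1)) := by
    refine setIntegral_congr_fun (measurableSet_dyadicCell _ _) fun x hx => ?_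
    simp only [glue, if_neg (not_lt.2 (h1.trans hx.1))]
  have h3 := cellAvg_eq_intervalIntegral (fun x => τ + σ * f₁ (2 * x - 1)) (n + 1) (2 ^ n + k)
  rw [cellAvg] at h3
  rw [cellAvg, h2, h3, integral_affine_rescale hm hC _ _ _ (by gcongr; linarith),
    cellAvg_eq_intervalIntegral]
  have e1 : 2 * (((2 ^ n + k : ℕ) : ℝ) / 2 ^ (n + 1)) - 1 = (k : ℝ) / 2 ^ n := by
    rw [pow_succ]; push_cast; field_simp; ring
  have e2 : 2 * ((((2 ^ n + k : ℕ) : ℝ) + 1) / 2 ^ (n + 1)) - 1 = ((k : ℝ) + 1) / 2 ^ n := by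
    rw [pow_succ]; push_cast; field_simp; ring
  rw [e1, e2, pow_succ]
  field_simp
  ring

/-- `f` is a bounded measurable function with zero mean and square function at most `1`, which is
at least `a` on a set of measure at least `1 - t`. -/
structure IsNearExtremal (a t : ℝ) (f : ℝ → ℝ) : Prop where
  measurable : Measurable f
  bounded : ∃ C, ∀ x, |f x| ≤ C
  cellAvg_zero : cellAvg f 0 0 = 0
  sqSum_le_one : ∀ n k, k < 2 ^ n → sqSum f n k ≤ 1
  le_volume : ENNReal.ofReal (1 - t) ≤ volume {y ∈ Set.Ico (0 : ℝ) 1 | a ≤ f y}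

lemma IsNearExtremal.integrableOn {a t : ℝ} {f : ℝ → ℝ} (h : IsNearExtremal a t f) :
    IntegrableOn f (Set.Ico 0 1) :=
  h.bounded.elim fun _ hC => integrableOn_Ico_of_bounded h.measurable hC 0 1

lemma IsNearExtremal.admissible {a t : ℝ} {f : ℝ → ℝ} (h : IsNearExtremal a t f) :
    Admissible f :=
  admissible_of_sqSum_le_one h.integrableOn h.cellAvg_zero h.sqSum_le_one

section Glue

variable {a t b s τ σ : ℝ} {f₀ f₁ : ℝ → ℝ} (h₀ : IsNearExtremal a t f₀)
  (h₁ : IsNearExtremal b s f₁)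
include h₀ h₁

lemma integrableOn_glue : IntegrableOn (glue τ σ f₀ f₁) (Set.Ico 0 1) := by
  obtain ⟨C₀, hC₀⟩ := h₀.bounded
  obtain ⟨C₁, hC₁⟩ := h₁.bounded
  exact integrableOn_Ico_of_bounded (measurable_glue h₀.measurable h₁.measurable)
    (abs_glue_le hC₀ hC₁) 0 1

lemma haarCoeff_glue_zero : haarCoeff (glue τ σ f₀ f₁) 0 0 = τ := by
  obtain ⟨C₀, hC₀⟩ := h₀.bounded
  obtain ⟨C₁, hC₁⟩ := h₁.bounded
  rw [haarCoeff_eq (integrableOn_glue h₀ h₁) (by simp)]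
  have e0 := cellAvg_glue_left (τ := τ) (σ := σ) h₀.measurable hC₀ f₁ (n := 0) (k := 0) (by simp)
  have e1 := cellAvg_glue_right (τ := τ) (σ := σ) h₁.measurable hC₁ f₀ 0 0
  rw [h₀.cellAvg_zero] at e0
  rw [h₁.cellAvg_zero] at e1
  simp only [pow_zero, add_zero, zero_add, mul_zero] at e0 e1 ⊢
  rw [e0, e1]; ring

lemma haarCoeff_glue_left {n k : ℕ} (hk : k < 2 ^ n) :
    haarCoeff (glue τ σ f₀ f₁) (n + 1) k = σ * haarCoeff f₀ n k := by
  obtain ⟨C₀, hC₀⟩ := h₀.bounded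
  rw [haarCoeff_eq (integrableOn_glue h₀ h₁) (by rw [pow_succ]; omega),
    haarCoeff_eq h₀.integrableOn hk,
    cellAvg_glue_left h₀.measurable hC₀ f₁ (by rw [pow_succ]; omega),
    cellAvg_glue_left h₀.measurable hC₀ f₁ (by rw [pow_succ]; omega)]
  ring

lemma haarCoeff_glue_right {n k : ℕ} (hk : k < 2 ^ n) :
    haarCoeff (glue τ σ f₀ f₁) (n + 1) (2 ^ n + k) = σ * haarCoeff f₁ n k := by
  obtain ⟨C₁, hC₁⟩ := h₁.bounded
  rw [haarCoeff_eq (integrableOn_glue h₀ h₁) (by rw [pow_succ]; omega),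
    haarCoeff_eq h₁.integrableOn hk,
    show 2 * (2 ^ n + k) + 1 = 2 ^ (n + 1) + (2 * k + 1) by rw [pow_succ]; ring,
    show 2 * (2 ^ n + k) = 2 ^ (n + 1) + 2 * k by rw [pow_succ]; ring,
    cellAvg_glue_right h₁.measurable hC₁ f₀, cellAvg_glue_right h₁.measurable hC₁ f₀]
  ring

lemma sqSum_glue (n : ℕ) : ∀ k < 2 ^ n,
    sqSum (glue τ σ f₀ f₁) (n + 1) k = τ ^ 2 + σ ^ 2 * sqSum f₀ n k ∧
    sqSum (glue τ σ f₀ f₁) (n + 1) (2 ^ n + k) = τ ^ 2 + σ ^ 2 * sqSum f₁ n k := by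
  induction n with
  | zero =>
    intro k hk
    obtain rfl : k = 0 := by simpa using hk
    simp [sqSum, haarCoeff_glue_zero h₀ h₁]
  | succ n ih =>
    intro k hk
    have hk2 : k / 2 < 2 ^ n := by rw [pow_succ] at hk; omega
    have e : (2 ^ (n + 1) + k) / 2 = 2 ^ n + k / 2 := by rw [pow_succ]; omega
    constructor
    · rw [sqSum, (ih _ hk2).1, haarCoeff_glue_left h₀ h₁ hk2, sqSum.eq_2 f₀]
      ring
    · rw [sqSum, e, (ih _ hk2).2, haarCoeff_glue_right h₀ h₁ hk2, sqSum.eq_2 f₁]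
      ring

lemma ofReal_le_volume_glue (hσ : 0 ≤ σ) (ht : t ≤ 1) (hs : s ≤ 1) {m : ℝ} (hm₀ : m = -τ + σ * a)
    (hm₁ : m = τ + σ * b) : ENNReal.ofReal (1 - (t + s) / 2)
      ≤ volume {y ∈ Set.Ico (0 : ℝ) 1 | m ≤ glue τ σ f₀ f₁ y} := by
  set S₀ := {y ∈ Set.Ico (0 : ℝ) 1 | a ≤ f₀ y} with hS₀
  set S₁ := {y ∈ Set.Ico (0 : ℝ) 1 | b ≤ f₁ y} with hS₁
  have hS₁m : MeasurableSet S₁ :=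
    measurableSet_Ico.inter (measurableSet_le measurable_const h₁.measurable)
  have hT₁m : MeasurableSet ((fun x : ℝ => 2 * x) ⁻¹' ((fun x : ℝ => x + -1) ⁻¹' S₁)) :=
    measurable_const_mul 2 ((measurable_add_const (-1)) hS₁m)
  have hv₀ : volume ((fun x : ℝ => 2 * x) ⁻¹' S₀) = ENNReal.ofReal (1 / 2) * volume S₀ := by
    rw [Real.volume_preimage_mul_left two_ne_zero]
    norm_num
  have hv₁ : volume ((fun x : ℝ => 2 * x) ⁻¹' ((fun x : ℝ => x + -1) ⁻¹' S₁))
      = ENNReal.ofReal (1 / 2) * volume S₁ := by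
    rw [Real.volume_preimage_mul_left two_ne_zero, measure_preimage_add_right]
    norm_num
  have hd : Disjoint ((fun x : ℝ => 2 * x) ⁻¹' S₀)
      ((fun x : ℝ => 2 * x) ⁻¹' ((fun x : ℝ => x + -1) ⁻¹' S₁)) := by
    refine Set.disjoint_left.2 fun x hx hx' => ?_
    have h1 : 2 * x < 1 := hx.1.2
    have h2 : 0 ≤ 2 * x + -1 := hx'.1.1
    linarith
  calc ENNReal.ofReal (1 - (t + s) / 2)
      = ENNReal.ofReal (1 / 2) * ENNReal.ofReal (1 - t)
        + ENNReal.ofReal (1 / 2) * ENNReal.ofReal (1 - s) := by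
        rw [← ENNReal.ofReal_mul (by norm_num), ← ENNReal.ofReal_mul (by norm_num),
          ← ENNReal.ofReal_add (by linarith) (by linarith)]
        congr 1; ring
    _ ≤ ENNReal.ofReal (1 / 2) * volume S₀ + ENNReal.ofReal (1 / 2) * volume S₁ := by
        gcongr
        · exact h₀.le_volume
        · exact h₁.le_volume
    _ = volume ((fun x : ℝ => 2 * x) ⁻¹' S₀
          ∪ (fun x : ℝ => 2 * x) ⁻¹' ((fun x : ℝ => x + -1) ⁻¹' S₁)) := by
        rw [measure_union hd hT₁m, hv₀, hv₁]
    _ ≤ _ := by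
        refine measure_mono ?_
        rintro x (⟨⟨h1, h2⟩, h3⟩ | ⟨⟨h1, h2⟩, h3⟩)
        · have h2' : 2 * x < 1 := h2
          have h1' : 0 ≤ 2 * x := h1
          refine ⟨⟨by linarith, by linarith⟩, ?_⟩
          rw [glue, if_pos (by linarith), hm₀]
          gcongr
        · have h2' : 2 * x + -1 < 1 := h2
          have h1' : 0 ≤ 2 * x + -1 := h1
          refine ⟨⟨by linarith, by linarith⟩, ?_⟩
          rw [glue, if_neg (by linarith), hm₁]
          gcongr
          exact h3

lemma IsNearExtremal.exists_nlMean (ht : t ≤ 1) (hs : s ≤ 1) :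
    ∃ f, IsNearExtremal (nlMean a b) ((t + s) / 2) f := by
  have hpos : 0 < √(4 + (a - b) ^ 2) := Real.sqrt_pos.2 (by positivity)
  have hsq := Real.sq_sqrt (show 0 ≤ 4 + (a - b) ^ 2 by positivity)
  set r := √(4 + (a - b) ^ 2) with hr
  have h1 : ((a - b) / r) ^ 2 + (2 / r) ^ 2 = 1 := by
    rw [div_pow, div_pow, hsq, ← add_div, div_eq_one_iff_eq (by positivity)]
    ring
  refine ⟨glue ((a - b) / r) (2 / r) f₀ f₁, measurable_glue h₀.measurable h₁.measurable,
    ?_, ?_, ?_, ?_⟩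
  · obtain ⟨C₀, hC₀⟩ := h₀.bounded
    obtain ⟨C₁, hC₁⟩ := h₁.bounded
    exact ⟨_, abs_glue_le hC₀ hC₁⟩
  · obtain ⟨C₀, hC₀⟩ := h₀.bounded
    obtain ⟨C₁, hC₁⟩ := h₁.bounded
    have e := cellAvg_add (integrableOn_glue (τ := (a - b) / r) (σ := 2 / r) h₀ h₁)
      (n := 0) (k := 0) (by simp)
    have e0 := cellAvg_glue_left (τ := (a - b) / r) (σ := 2 / r) h₀.measurable hC₀ f₁
      (n := 0) (k := 0) (by simp)
    have e1 := cellAvg_glue_right (τ := (a - b) / r) (σ := 2 / r) h₁.measurable hC₁ f₀ 0 0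
    rw [h₀.cellAvg_zero] at e0
    rw [h₁.cellAvg_zero] at e1
    simp only [pow_zero, add_zero, zero_add, mul_zero] at e e0 e1
    linarith
  · intro n k hk
    have hle : ∀ q : ℝ, q ≤ 1 → ((a - b) / r) ^ 2 + (2 / r) ^ 2 * q ≤ 1 := fun q hq => by
      nlinarith [sq_nonneg (2 / r)]
    cases n with
    | zero => simp [sqSum]
    | succ n =>
      obtain hlt | hge := lt_or_ge k (2 ^ n)
      · rw [(sqSum_glue h₀ h₁ n k hlt).1]
        exact hle _ (h₀.sqSum_le_one n k hlt)
      · obtain ⟨j, rfl⟩ := Nat.exists_eq_add_of_le hge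
        have hj : j < 2 ^ n := by rw [pow_succ] at hk; omega
        rw [(sqSum_glue h₀ h₁ n j hj).2]
        exact hle _ (h₁.sqSum_le_one n j hj)
  · refine ofReal_le_volume_glue h₀ h₁ (by positivity) ht hs ?_ ?_
    · rw [nlMean, ← hr]; field_simp; ring
    · rw [nlMean, ← hr]; field_simp; ring

end Glue

lemma isNearExtremal_zero : IsNearExtremal 0 0 (fun _ => 0) where
  measurable := measurable_const
  bounded := ⟨0, by simp⟩
  cellAvg_zero := by simp [cellAvg]
  sqSum_le_one n k _ := by
    have : ∀ n k, sqSum (fun _ => 0) n k = 0 := by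
      intro n
      induction n with
      | zero => intro k; rfl
      | succ n ih => intro k; simp [sqSum, ih, haarCoeff]
    rw [this]; exact zero_le_one
  le_volume := by
    rw [← Real.volume_Ico]
    exact measure_mono fun x hx => ⟨hx, le_rfl⟩

lemma isNearExtremal_one_half : IsNearExtremal 1 (1 / 2) (glue 1 0 (fun _ => 0) (fun _ => 0)) where
  measurable := measurable_glue measurable_const measurable_const
  bounded := ⟨_, abs_glue_le (C₀ := 0) (C₁ := 0) (by simp) (by simp)⟩
  cellAvg_zero := by
    have e := cellAvg_add (integrableOn_glue (τ := 1) (σ := 0) isNearExtremal_zero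
      isNearExtremal_zero) (n := 0) (k := 0) (by simp)
    have e0 := cellAvg_glue_left (τ := 1) (σ := 0) (f₀ := fun _ => 0) (C := 0) measurable_const
      (by simp) (fun _ => 0) (n := 0) (k := 0) (by simp)
    have e1 := cellAvg_glue_right (τ := 1) (σ := 0) (f₁ := fun _ => 0) (C := 0) measurable_const
      (by simp) (fun _ => 0) 0 0
    simp only [pow_zero, add_zero, zero_add, mul_zero, zero_mul] at e e0 e1
    linarith
  sqSum_le_one n k hk := by
    cases n with
    | zero => simp [sqSum]
    | succ n =>
      obtain hlt | hge := lt_or_ge k (2 ^ n)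
      · rw [(sqSum_glue isNearExtremal_zero isNearExtremal_zero n k hlt).1]
        simp
      · obtain ⟨j, rfl⟩ := Nat.exists_eq_add_of_le hge
        have hj : j < 2 ^ n := by rw [pow_succ] at hk; omega
        rw [(sqSum_glue isNearExtremal_zero isNearExtremal_zero n j hj).2]
        simp
  le_volume := by
    rw [← Real.volume_Ico]
    refine measure_mono fun x hx => ⟨⟨by linarith [hx.1], hx.2⟩, ?_⟩
    rw [glue, if_neg (not_lt.2 hx.1)]
    simp

lemma IsBridge.exists_isNearExtremal {A : ℝ → ℝ} (h : IsBridge A) (n : ℕ) :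
    ∀ k ≤ 2 ^ n, ∃ f, IsNearExtremal (gridVal A n k) ((k : ℝ) / 2 ^ (n + 1)) f := by
  induction n with
  | zero =>
    intro k hk
    obtain rfl | rfl : k = 0 ∨ k = 1 := by
      rw [pow_zero] at hk; omega
    · exact ⟨_, by simpa [gridVal, h.zero] using isNearExtremal_zero⟩
    · refine ⟨glue 1 0 (fun _ => 0) (fun _ => 0), ?_⟩
      rw [show gridVal A 0 1 = 1 from h.gridVal_top 0]
      simpa using isNearExtremal_one_half
  | succ n ih =>
    intro k hk
    obtain ⟨j, rfl | rfl⟩ : ∃ j, k = 2 * j ∨ k = 2 * j + 1 := ⟨k / 2, by omega⟩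
    · obtain ⟨f, hf⟩ := ih j (by rw [pow_succ] at hk; omega)
      refine ⟨f, ?_⟩
      have e : ((2 * j : ℕ) : ℝ) / 2 ^ (n + 1 + 1) = (j : ℝ) / 2 ^ (n + 1) := by
        rw [pow_succ]; push_cast; field_simp
      rw [gridVal, e]
      exact hf
    · have hj : j < 2 ^ n := by rw [pow_succ] at hk; omega
      obtain ⟨f₀, h₀⟩ := ih j hj.le
      obtain ⟨f₁, h₁⟩ := ih (j + 1) hj
      have ht : ∀ i : ℕ, i ≤ 2 ^ n → (i : ℝ) / 2 ^ (n + 1) ≤ 1 := fun i hi =>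
        (grid_mem hi).2.trans (by norm_num)
      obtain ⟨f, hf⟩ := h₀.exists_nlMean h₁ (ht j hj.le) (ht (j + 1) hj)
      refine ⟨f, ?_⟩
      have e : ((2 * j + 1 : ℕ) : ℝ) / 2 ^ (n + 1 + 1)
          = ((j : ℝ) / 2 ^ (n + 1) + ((j + 1 : ℕ) : ℝ) / 2 ^ (n + 1)) / 2 := by
        rw [pow_succ]; push_cast; field_simp; ring
      rw [h.gridVal_odd hj, e]
      exact hf

lemma IsBridge.le_bellman {A : ℝ → ℝ} (h : IsBridge A) {t : ℝ}
    (ht : t ∈ Set.Icc (0 : ℝ) (1 / 2)) : 1 - t ≤ bellman (A t) := by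
  have hbdd : BddAbove {m : ℝ | ∃ f : ℝ → ℝ, Admissible f ∧
      m = (volume {y ∈ Set.Icc (0 : ℝ) 1 | A t ≤ f y}).toReal} := by
    refine ⟨1, ?_⟩
    rintro m ⟨f, -, rfl⟩
    have : (volume {y ∈ Set.Icc (0 : ℝ) 1 | A t ≤ f y}).toReal
        ≤ (volume (Set.Icc (0 : ℝ) 1)).toReal :=
      ENNReal.toReal_mono (by simp) (measure_mono fun y hy => hy.1)
    simpa using this
  have key : ∀ n : ℕ, 1 - t - (1 / 2) ^ (n + 1) ≤ bellman (A t) := by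
    intro n
    have hk : ⌈t * 2 ^ (n + 1)⌉₊ ≤ 2 ^ n := by
      rw [Nat.ceil_le, pow_succ]
      push_cast
      nlinarith [ht.2, pow_pos (two_pos : (0 : ℝ) < 2) n]
    obtain ⟨f, hf⟩ := h.exists_isNearExtremal n _ hk
    have hle : t ≤ (⌈t * 2 ^ (n + 1)⌉₊ : ℝ) / 2 ^ (n + 1) := by
      rw [le_div_iff₀ (by positivity)]
      exact Nat.le_ceil _
    have hge : (⌈t * 2 ^ (n + 1)⌉₊ : ℝ) / 2 ^ (n + 1) ≤ t + (1 / 2) ^ (n + 1) := by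
      rw [div_le_iff₀ (by positivity), add_mul, ← mul_pow]
      have := (Nat.ceil_lt_add_one (mul_nonneg ht.1 (by positivity : (0 : ℝ) ≤ 2 ^ (n + 1)))).le
      norm_num at this ⊢
      linarith
    have hA : A t ≤ gridVal A n ⌈t * 2 ^ (n + 1)⌉₊ := h.mono.monotoneOn ht (grid_mem hk) hle
    refine le_trans ?_ (le_csSup hbdd ⟨f, hf.admissible, rfl⟩)
    have hv : ENNReal.ofReal (1 - (⌈t * 2 ^ (n + 1)⌉₊ : ℝ) / 2 ^ (n + 1))
        ≤ volume {y ∈ Set.Icc (0 : ℝ) 1 | A t ≤ f y} :=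
      hf.le_volume.trans (measure_mono fun y hy => ⟨Set.Ico_subset_Icc_self hy.1, hA.trans hy.2⟩)
    have hfin : volume {y ∈ Set.Icc (0 : ℝ) 1 | A t ≤ f y} ≠ ∞ :=
      measure_ne_top_of_subset (fun y hy => hy.1) (by simp)
    have := (ENNReal.ofReal_le_iff_le_toReal hfin).1 hv
    linarith
  have hlim : Tendsto (fun n : ℕ => 1 - t - (1 / 2 : ℝ) ^ (n + 1)) atTop (𝓝 (1 - t - 0)) :=
    ((tendsto_pow_atTop_nhds_zero_of_lt_one (by norm_num) (by norm_num)).comp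
      (tendsto_add_atTop_nat 1)).const_sub _
  rw [sub_zero] at hlim
  exact le_of_tendsto' hlim key

end LowerBound

theorem bellman_eq_one_sub_bridge_inverse
    (A : ℝ → ℝ)
    (hAcont : ContinuousOn A (Set.Icc 0 (1 / 2)))
    (hA0 : A 0 = 0) (hAhalf : A (1 / 2) = 1)
    (hArec : ∀ n : ℕ, 2 ≤ n → ∀ k : ℕ, Odd k → k < 2 ^ (n - 1) →
      A ((k : ℝ) / 2 ^ n) =
        nlMean (A (((k : ℝ) - 1) / 2 ^ n)) (A (((k : ℝ) + 1) / 2 ^ n)))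
    (hAmono : StrictMonoOn A (Set.Icc 0 (1 / 2)))
    (Ainv : ℝ → ℝ)
    (hAinv : ∀ t ∈ Set.Icc (0 : ℝ) (1 / 2), Ainv (A t) = t)
    (hAinv' : ∀ x ∈ Set.Icc (0 : ℝ) 1, Ainv x ∈ Set.Icc (0 : ℝ) (1 / 2) ∧ A (Ainv x) = x) :
    ∀ x ∈ Set.Icc (0 : ℝ) 1, bellman x = 1 - Ainv x := by
  have h : IsBridge A := ⟨hAcont, hA0, hAhalf, hArec, hAmono⟩
  intro x hx
  obtain ⟨ht, hAt⟩ := hAinv' x hx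
  refine le_antisymm (csSup_le ⟨_, _, isNearExtremal_zero.admissible, rfl⟩ ?_) ?_
  · rintro m ⟨f, hf, rfl⟩
    exact hf.volume_toReal_le h hAinv hAinv' hx
  · simpa only [hAt] using h.le_bellman ht
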